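/- Fix integers r ≥ 2 and λ̃ ≥ 1, set λ = rλ̃ − r + 1, and fix positive integers n ≥ 2 and p with m = pλ. Let Q : ℝ^m → {±1}^m be any map such that for every y ∈ ℝ^m with ‖y‖_∞ ≤ 8/9 there exists u_y ∈ ℝ^m with y − Q(y) = D^r u_y and ‖u_y‖_∞ ≤ c₀, for some constant c₀ > 0. Let 𝒯 be a finite subset of {x ∈ ℝ^n : ‖x‖₁ ≤ 1}, fix α ∈ (0,1), ρ ∈ (0,1), ν > 0, and an integer k ≥ 40(log(8|𝒯|) + ν). Then there exist constants C₁, C₂ > 0 depending only on r and c₀ such that if m ≥ p ≥ C₁·k·log⁴(n)/(α²ρ²), then with probability at least 1 − ρ − e^{−ν} over the draw of Φ and D_ε, the map f : 𝒯 → {±1}^m defined by f(x) = Q((8/9)·Φ D_ε x) satisfies, for all x, x̃ ∈ 𝒯: | ‖Ṽ(f(x) − f(x̃))‖₂ − ‖x − x̃‖₂ | ≤ α·‖x − x̃‖₂ + C₂·λ^{−r+1/2}. -/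

import Mathlib

open scoped BigOperators Matrix
noncomputable section

/-- The sign `±1` associated with a boolean. -/
def rsign (b : Bool) : ℝ := if b then 1 else -1

/-- `ℓ¹` norm of a real vector. -/
def norm1 {n : ℕ} (x : Fin n → ℝ) : ℝ := ∑ j, |x j|

/-- Euclidean norm of a real vector. -/
def norm2 {n : ℕ} (x : Fin n → ℝ) : ℝ := Real.sqrt (∑ j, (x j) ^ 2)

/-- `ℓ∞` norm of a real vector. -/
def normInf {n : ℕ} (x : Fin n → ℝ) : ℝ := ⨆ j, |x j|

/-- The ΣΔ condensation vector: the `j`-th entry (0-indexed) is the coefficient of `z^j`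
in the polynomial `(1 + z + ⋯ + z^(lamt-1))^r`. -/
def sdVec (r lamt : ℕ) {lam : ℕ} : Fin lam → ℝ :=
  fun j => ((∑ t ∈ Finset.range lamt, (Polynomial.X : Polynomial ℝ) ^ t) ^ r).coeff (j : ℕ)

/-- Block-diagonal matrix `I_p ⊗ v` with `p` copies of the row vector `v` on the diagonal. -/
def kronRow (p : ℕ) {lam : ℕ} (v : Fin lam → ℝ) : Matrix (Fin p) (Fin (p * lam)) ℝ :=
  Matrix.of fun i j =>
    if (j : ℕ) / lam = (i : ℕ) then
      (if h2 : (j : ℕ) % lam < lam then v ⟨(j : ℕ) % lam, h2⟩ else 0)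
    else 0

/-- The `m×m` first-order difference matrix. -/
def diffMat (m : ℕ) : Matrix (Fin m) (Fin m) ℝ :=
  Matrix.of fun i j =>
    if (i : ℕ) = (j : ℕ) then 1 else if (i : ℕ) = (j : ℕ) + 1 then -1 else 0

/-- Probability of an event under the uniform distribution on a finite sample space. -/
def unifProb {Ω : Type*} [Fintype Ω] (P : Ω → Prop) : ℝ :=
  (Nat.card {ω : Ω // P ω} : ℝ) / (Fintype.card Ω : ℝ)

set_option linter.unusedSectionVars false

section SignAverages

variable {α : Type*}

/-- The real sign vector of a boolean vector. -/
def sg (σ : α → Bool) : α → ℝ := fun t => rsign (σ t)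

/-- Restriction of a vector to the coordinates selected by `b`. -/
def mask (b : α → Bool) (a : α → ℝ) : α → ℝ := fun t => if b t then a t else 0

/-- The complementary selection. -/
def cosel (b : α → Bool) : α → Bool := fun t => !b t

lemma sg_sq (σ : α → Bool) (t : α) : sg σ t ^ 2 = 1 := by
  unfold sg rsign; split_ifs <;> norm_num

lemma abs_sg (σ : α → Bool) (t : α) : |sg σ t| = 1 := by
  unfold sg rsign; split_ifs <;> norm_num

lemma mask_add_mask_cosel (b : α → Bool) (a : α → ℝ) : mask b a + mask (cosel b) a = a := by
  funext t; by_cases h : b t <;> simp [mask, cosel, h]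

lemma mask_sg_congr {b σ τ : α → Bool} (h : ∀ t, b t = true → σ t = τ t) :
    mask b (sg σ) = mask b (sg τ) := by
  funext t
  by_cases hb : b t <;> simp [mask, sg, hb, h]

variable [Fintype α]

lemma sum_mask_sq_le (b : α → Bool) (a : α → ℝ) : ∑ t, mask b a t ^ 2 ≤ ∑ t, a t ^ 2 := by
  refine Finset.sum_le_sum fun t _ => ?_
  unfold mask; split_ifs
  · exact le_rfl
  · simpa using sq_nonneg (a t)

lemma exp_expect_le {Ω : Type*} [Fintype Ω] [Nonempty Ω] (f : Ω → ℝ) :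
    Real.exp (𝔼 ω, f ω) ≤ 𝔼 ω, Real.exp (f ω) := by
  set m := 𝔼 ω, f ω with hm
  have h : 𝔼 ω, Real.exp m * (1 + (f ω - m)) ≤ 𝔼 ω, Real.exp (f ω) := by
    refine Finset.expect_le_expect fun ω _ => ?_
    have := Real.add_one_le_exp (f ω - m)
    calc _ ≤ Real.exp m * Real.exp (f ω - m) := by
          refine mul_le_mul_of_nonneg_left ?_ (Real.exp_pos m).le; linarith
      _ = _ := by rw [← Real.exp_add]; ring_nf
  refine le_trans (le_of_eq ?_) h
  rw [← Finset.mul_expect, Finset.expect_add_distrib, Finset.expect_sub_distrib,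
    Fintype.expect_const, Fintype.expect_const, ← hm]
  ring

variable [DecidableEq α]

lemma expect_prod_bool (f : α → Bool → ℝ) :
    𝔼 σ : α → Bool, ∏ t, f t (σ t) = ∏ t, ((f t true + f t false) / 2) := by
  rw [Fintype.expect_eq_sum_div_card, Finset.prod_div_distrib]
  have h := Finset.prod_univ_sum (fun _ : α => (Finset.univ : Finset Bool)) f
  simp only [Fintype.piFinset_univ, Fintype.sum_bool] at h
  rw [h]
  simp

/-- Hoeffding's bound for the moment generating function of a Rademacher sum. -/
lemma expect_exp_le (a : α → ℝ) :
    𝔼 σ : α → Bool, Real.exp (∑ t, a t * sg σ t) ≤ Real.exp ((∑ t, a t ^ 2) / 2) := by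
  simp only [Real.exp_sum, sg]
  rw [expect_prod_bool (fun t b => Real.exp (a t * rsign b)), Finset.sum_div, Real.exp_sum]
  refine Finset.prod_le_prod (fun t _ => by positivity) fun t _ => ?_
  have := Real.cosh_le_exp_half_sq (a t)
  rw [Real.cosh_eq] at this
  simpa [rsign] using this

/-- Maximal inequality for finitely many Rademacher sums, in selector form. -/
lemma expect_abs_selector_le {ι : Type*} (s : Finset ι) (sel : (α → Bool) → ι)
    (hsel : ∀ σ, sel σ ∈ s) (a : ι → α → ℝ) (S N : ℝ) (hS : 0 ≤ S) (hN : 1 ≤ N)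
    (hsN : (s.card : ℝ) ≤ N) (ha : ∀ i ∈ s, ∑ t, a i t ^ 2 ≤ S ^ 2) :
    𝔼 σ : α → Bool, |∑ t, a (sel σ) t * sg σ t| ≤ S * Real.sqrt (2 * Real.log (2 * N)) := by
  have hlog : 0 < Real.log (2 * N) := Real.log_pos (by linarith)
  rcases hS.eq_or_lt with rfl | hS
  · have : ∀ σ : α → Bool, |∑ t, a (sel σ) t * sg σ t| = 0 := by
      intro σ
      have h := ha _ (hsel σ)
      have h0 : ∀ t, a (sel σ) t = 0 := by
        intro t
        have h2 := Finset.single_le_sum (f := fun t => a (sel σ) t ^ 2)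
          (fun t _ => sq_nonneg _) (Finset.mem_univ t)
        have : a (sel σ) t ^ 2 = 0 := le_antisymm (by simp at h h2; linarith) (sq_nonneg _)
        simpa using this
      simp [h0]
    simp [this]
  set q := Real.sqrt (2 * Real.log (2 * N)) with hq
  have hqpos : 0 < q := Real.sqrt_pos.mpr (by linarith)
  have hq2 : q ^ 2 = 2 * Real.log (2 * N) := Real.sq_sqrt (by linarith)
  set θ := q / S with hθ
  have hθpos : 0 < θ := div_pos hqpos hS
  have hθS : θ ^ 2 * S ^ 2 = q ^ 2 := by rw [hθ]; field_simp
  have key : ∀ σ : α → Bool, θ * |∑ t, a (sel σ) t * sg σ t| - q ^ 2 + 1 ≤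
      Real.exp (-q ^ 2) * ∑ i ∈ s, (Real.exp (∑ t, (θ * a i t) * sg σ t)
        + Real.exp (∑ t, (-θ * a i t) * sg σ t)) := by
    intro σ
    have h1 := Real.add_one_le_exp (θ * |∑ t, a (sel σ) t * sg σ t| - q ^ 2)
    refine h1.trans ?_
    rw [sub_eq_add_neg, Real.exp_add, mul_comm]
    refine mul_le_mul_of_nonneg_left ?_ (Real.exp_pos _).le
    refine le_trans ?_ (Finset.single_le_sum (f := fun i =>
      (Real.exp (∑ t, (θ * a i t) * sg σ t) + Real.exp (∑ t, (-θ * a i t) * sg σ t)))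
      (fun i _ => by positivity) (hsel σ))
    simp only [mul_assoc, ← Finset.mul_sum]
    rcases abs_cases (∑ t, a (sel σ) t * sg σ t) with ⟨h, _⟩ | ⟨h, _⟩ <;> rw [h]
    · have := Real.exp_pos (-θ * ∑ t, a (sel σ) t * sg σ t); linarith
    · have := Real.exp_pos (θ * ∑ t, a (sel σ) t * sg σ t)
      rw [mul_neg, ← neg_mul]; linarith
  have h2 := Finset.expect_le_expect (s := Finset.univ) (fun σ _ => key σ)
  rw [← Finset.mul_expect, Finset.expect_sum_comm, Finset.expect_add_distrib,
    Finset.expect_sub_distrib, Fintype.expect_const, Fintype.expect_const,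
    ← Finset.mul_expect] at h2
  have h3 : ∑ i ∈ s, 𝔼 σ : α → Bool, (Real.exp (∑ t, (θ * a i t) * sg σ t)
        + Real.exp (∑ t, (-θ * a i t) * sg σ t)) ≤ ∑ i ∈ s, 2 * Real.exp (q ^ 2 / 2) := by
    refine Finset.sum_le_sum fun i hi => ?_
    rw [Finset.expect_add_distrib]
    have e1 := expect_exp_le (fun t => θ * a i t)
    have e2 := expect_exp_le (fun t => -θ * a i t)
    have e3 : (∑ t, (θ * a i t) ^ 2) / 2 ≤ q ^ 2 / 2 := by
      simp only [mul_pow, ← Finset.mul_sum, ← hθS]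
      have := mul_le_mul_of_nonneg_left (ha i hi) (sq_nonneg θ)
      linarith
    have e4 : (∑ t, (-θ * a i t) ^ 2) / 2 ≤ q ^ 2 / 2 := by
      simpa [mul_pow] using e3
    have := Real.exp_le_exp.mpr e3
    have := Real.exp_le_exp.mpr e4
    linarith
  rw [Finset.sum_const, nsmul_eq_mul] at h3
  have h4 : Real.exp (-q ^ 2) * (s.card * (2 * Real.exp (q ^ 2 / 2))) ≤ 1 := by
    have e : Real.exp (q ^ 2 / 2) = 2 * N := by
      rw [hq2, mul_div_cancel_left₀ _ two_ne_zero, Real.exp_log (by linarith)]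
    have e' : Real.exp (-q ^ 2) = ((2 * N) ^ 2)⁻¹ := by
      rw [Real.exp_neg, ← e, ← Real.exp_nat_mul]; congr 2; push_cast; ring
    rw [e, e', inv_mul_le_iff₀ (by positivity)]
    nlinarith
  have h5 := mul_le_mul_of_nonneg_left h3 (Real.exp_pos (-q ^ 2)).le
  have h6 : θ * 𝔼 σ : α → Bool, |∑ t, a (sel σ) t * sg σ t| ≤ q ^ 2 := by linarith
  have h7 : S * q = q ^ 2 / θ := by rw [hθ]; field_simp
  rw [h7, le_div_iff₀ hθpos]; linarith

/-- The two halves of a sign vector along a selection are independent. -/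
lemma expect_mask_indep (b : α → Bool) (F : (α → ℝ) → (α → ℝ) → ℝ) :
    𝔼 σ : α → Bool, F (mask b (sg σ)) (mask (cosel b) (sg σ)) =
      𝔼 σ : α → Bool, 𝔼 τ : α → Bool, F (mask b (sg σ)) (mask (cosel b) (sg τ)) := by
  let mg : (α → Bool) → (α → Bool) → (α → Bool) := fun σ τ t => if b t then σ t else τ t
  have hinv : Function.Involutive
      (fun x : (α → Bool) × (α → Bool) => (mg x.1 x.2, mg x.2 x.1)) := by
    rintro ⟨σ, τ⟩
    ext t <;> by_cases h : b t <;> simp [mg, h]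
  have h1 : 𝔼 σ : α → Bool, 𝔼 τ : α → Bool, F (mask b (sg σ)) (mask (cosel b) (sg τ)) =
      𝔼 x : (α → Bool) × (α → Bool), F (mask b (sg x.1)) (mask (cosel b) (sg x.2)) := by
    rw [← Finset.univ_product_univ, Finset.expect_product]
  have h2 : 𝔼 σ : α → Bool, F (mask b (sg σ)) (mask (cosel b) (sg σ)) =
      𝔼 x : (α → Bool) × (α → Bool), F (mask b (sg x.1)) (mask (cosel b) (sg x.1)) := by
    rw [← Finset.univ_product_univ, Finset.expect_product]
    simp
  rw [h1, h2]
  symm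
  refine Fintype.expect_equiv hinv.toPerm _ _ fun x => ?_
  have e1 : mask b (sg (mg x.1 x.2)) = mask b (sg x.1) :=
    mask_sg_congr fun t ht => by simp [mg, ht]
  have e2 : mask (cosel b) (sg (mg x.1 x.2)) = mask (cosel b) (sg x.2) :=
    mask_sg_congr fun t ht => by
      have : b t = false := by simpa [cosel] using ht
      simp [mg, this]
  simp only [Function.Involutive.coe_toPerm, e1, e2]

lemma expect_flip (s : α) (F : (α → Bool) → ℝ) :
    𝔼 b : α → Bool, F b = 𝔼 b : α → Bool, F (Function.update b s (!b s)) := by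
  have hinv : Function.Involutive (fun b : α → Bool => Function.update b s (!b s)) := by
    intro b; simp
  symm
  exact Fintype.expect_equiv hinv.toPerm _ _ fun x => rfl

lemma expect_sg (s : α) : 𝔼 b : α → Bool, sg b s = 0 := by
  have h := expect_flip s (fun b => sg b s)
  have h2 : ∀ b : α → Bool, sg (Function.update b s (!b s)) s = - sg b s := by
    intro b; simp only [sg, rsign, Function.update_self]; cases b s <;> simp
  simp only [h2, Finset.expect_neg_distrib] at h
  linarith

lemma expect_sg_mul_sg {s t : α} (hst : s ≠ t) : 𝔼 b : α → Bool, sg b s * sg b t = 0 := by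
  have h := expect_flip s (fun b => sg b s * sg b t)
  have h2 : ∀ b : α → Bool, sg (Function.update b s (!b s)) s
      * sg (Function.update b s (!b s)) t = - (sg b s * sg b t) := by
    intro b
    simp only [sg, rsign, Function.update_self, Function.update_of_ne hst.symm]
    cases b s <;> cases b t <;> simp
  simp only [h2, Finset.expect_neg_distrib] at h
  linarith

/-- An off-diagonal sum is four times the average of its random bipartite restrictions. -/
lemma offdiag_eq (W : α → α → ℝ) (x : α → ℝ) :
    ∑ s, ∑ t, (if s = t then 0 else W s t * x s * x t) =
      4 * 𝔼 b : α → Bool, ∑ s, ∑ t, W s t * mask b x s * mask (cosel b) x t := by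
  rw [Finset.expect_sum_comm, Finset.mul_sum]
  refine Finset.sum_congr rfl fun s _ => ?_
  rw [Finset.expect_sum_comm, Finset.mul_sum]
  refine Finset.sum_congr rfl fun t _ => ?_
  have hm : ∀ b : α → Bool, mask b x s * mask (cosel b) x t =
      x s * x t / 4 * (1 + sg b s - sg b t - sg b s * sg b t) := by
    intro b
    simp only [mask, cosel, sg, rsign]
    by_cases h1 : b s = true <;> by_cases h2 : b t = true <;> simp [h1, h2] <;> ring
  simp only [mul_assoc, ← Finset.mul_expect, hm]
  rw [Finset.expect_sub_distrib, Finset.expect_sub_distrib, Finset.expect_add_distrib,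
    expect_sg, expect_sg, Fintype.expect_const]
  split_ifs with h
  · subst h
    simp [← sq, sg_sq]
  · rw [expect_sg_mul_sg h]; ring

/-- Decoupling bound for the moment generating function of an off-diagonal chaos. -/
lemma expect_exp_offdiag_le (W : α → α → ℝ) :
    𝔼 σ : α → Bool, Real.exp (∑ s, ∑ t, (if s = t then 0 else W s t * sg σ s * sg σ t)) ≤
      𝔼 b : α → Bool, 𝔼 σ : α → Bool,
        Real.exp (8 * ∑ t, (mask (cosel b) (fun t => ∑ s, W s t * mask b (sg σ) s) t) ^ 2) := by
  have h1 : ∀ σ : α → Bool,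
      Real.exp (∑ s, ∑ t, (if s = t then 0 else W s t * sg σ s * sg σ t)) ≤
      𝔼 b : α → Bool, Real.exp (4 * ∑ s, ∑ t, W s t * mask b (sg σ) s
        * mask (cosel b) (sg σ) t) := by
    intro σ
    rw [offdiag_eq, Finset.mul_expect]
    exact exp_expect_le _
  refine (Finset.expect_le_expect fun σ _ => h1 σ).trans ?_
  rw [Finset.expect_comm]
  refine Finset.expect_le_expect fun b _ => ?_
  rw [expect_mask_indep b (fun x y => Real.exp (4 * ∑ s, ∑ t, W s t * x s * y t))]
  refine Finset.expect_le_expect fun σ _ => ?_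
  have h2 : ∀ τ : α → Bool, 4 * ∑ s, ∑ t, W s t * mask b (sg σ) s * mask (cosel b) (sg τ) t =
      ∑ t, (4 * mask (cosel b) (fun t => ∑ s, W s t * mask b (sg σ) s) t) * sg τ t := by
    intro τ
    rw [Finset.sum_comm, Finset.mul_sum]
    refine Finset.sum_congr rfl fun t _ => ?_
    rw [← Finset.sum_mul]
    by_cases h : b t = true <;> simp [mask, cosel, h]
    ring
  simp only [h2]
  refine (expect_exp_le _).trans (Real.exp_le_exp.mpr (le_of_eq ?_))
  simp only [mul_pow, ← Finset.mul_sum]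
  ring

end SignAverages

section Chaos

variable {α β γ : Type*} [Fintype α] [Fintype β] [Fintype γ]

/-- `κ` bounds the operator norm of `A` with respect to Euclidean norms. -/
def OpLe (A : β → α → ℝ) (κ : ℝ) : Prop :=
  ∀ a : α → ℝ, ∑ t, (∑ s, A t s * a s) ^ 2 ≤ κ ^ 2 * ∑ s, a s ^ 2

lemma OpLe.transpose {A : β → α → ℝ} {κ : ℝ} (h : OpLe A κ) : OpLe (fun s t => A t s) κ := by
  intro c
  set x : α → ℝ := fun s => ∑ t, A t s * c t with hx
  have h1 : ∑ s, x s ^ 2 = ∑ t, c t * ∑ s, A t s * x s := by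
    simp only [Finset.mul_sum]
    rw [Finset.sum_comm]
    refine Finset.sum_congr rfl fun s _ => ?_
    have : x s ^ 2 = (∑ t, A t s * c t) * x s := by rw [sq]
    rw [this, Finset.sum_mul]
    exact Finset.sum_congr rfl fun t _ => by ring
  have h2 : (∑ s, x s ^ 2) ^ 2 ≤ (∑ t, c t ^ 2) * (κ ^ 2 * ∑ s, x s ^ 2) := by
    nth_rewrite 1 [h1]
    refine (Finset.sum_mul_sq_le_sq_mul_sq _ _ _).trans ?_
    exact mul_le_mul_of_nonneg_left (h x) (Finset.sum_nonneg fun _ _ => sq_nonneg _)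
  have h0 : 0 ≤ ∑ s, x s ^ 2 := Finset.sum_nonneg fun _ _ => sq_nonneg _
  have hc : 0 ≤ ∑ t, c t ^ 2 := Finset.sum_nonneg fun _ _ => sq_nonneg _
  change ∑ s, x s ^ 2 ≤ _
  rcases h0.eq_or_lt with h0 | h0
  · rw [← h0]; positivity
  · by_contra hcon
    push Not at hcon
    nlinarith

lemma OpLe.comp {A : γ → β → ℝ} {B : β → α → ℝ} {κ μ : ℝ} (hA : OpLe A κ) (hB : OpLe B μ) :
    OpLe (fun t s => ∑ u, A t u * B u s) (κ * μ) := by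
  intro a
  have h1 : ∀ t, ∑ s, (∑ u, A t u * B u s) * a s = ∑ u, A t u * ∑ s, B u s * a s := by
    intro t
    simp only [Finset.mul_sum, Finset.sum_mul]
    rw [Finset.sum_comm]
    exact Finset.sum_congr rfl fun _ _ => Finset.sum_congr rfl fun _ _ => by ring
  simp only [h1]
  refine (hA _).trans ?_
  rw [mul_pow, mul_assoc]
  exact mul_le_mul_of_nonneg_left (hB a) (sq_nonneg κ)

lemma OpLe.mask_smul {A : β → α → ℝ} {κ : ℝ} (h : OpLe A κ) (b : β → Bool) (c : α → Bool)
    (q : ℝ) :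
    OpLe (fun t s => q * (if b t then (if c s then A t s else 0) else 0)) (q * κ) := by
  intro a
  have h1 : ∀ t, (∑ s, (q * (if b t then (if c s then A t s else 0) else 0)) * a s) ^ 2 ≤
      q ^ 2 * (∑ s, A t s * mask c a s) ^ 2 := by
    intro t
    by_cases hb : b t = true
    · rw [← mul_pow, Finset.mul_sum]
      refine le_of_eq (congrArg (· ^ 2) (Finset.sum_congr rfl fun s _ => ?_))
      by_cases hc : c s = true <;> simp [mask, hb, hc]
      ring
    · simp [hb]; positivity
  refine (Finset.sum_le_sum fun t _ => h1 t).trans ?_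
  rw [← Finset.mul_sum, mul_pow, mul_assoc]
  refine mul_le_mul_of_nonneg_left ((h _).trans ?_) (sq_nonneg q)
  exact mul_le_mul_of_nonneg_left (sum_mask_sq_le c a) (sq_nonneg κ)

lemma sum_sum_mask_sq_le (A : β → α → ℝ) (b : β → Bool) (c : α → Bool) (q : ℝ) :
    ∑ t, ∑ s, (q * (if b t then (if c s then A t s else 0) else 0)) ^ 2 ≤
      q ^ 2 * ∑ t, ∑ s, A t s ^ 2 := by
  simp only [Finset.mul_sum]
  refine Finset.sum_le_sum fun t _ => Finset.sum_le_sum fun s _ => ?_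
  rw [mul_pow]
  refine mul_le_mul_of_nonneg_left ?_ (sq_nonneg q)
  split_ifs
  · exact le_rfl
  all_goals simp; positivity

variable [DecidableEq α]

lemma sum_sq_mulVec_eq (A : β → α → ℝ) (x : α → ℝ) :
    ∑ t, (∑ s, A t s * x s) ^ 2 = ∑ s, (∑ t, A t s ^ 2) * x s ^ 2 +
      ∑ s, ∑ s', (if s = s' then 0 else (∑ t, A t s * A t s') * x s * x s') := by
  have h1 : ∑ t, (∑ s, A t s * x s) ^ 2 =
      ∑ s, ∑ s', (∑ t, A t s * A t s') * x s * x s' := by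
    simp only [sq, Finset.sum_mul, Finset.mul_sum]
    rw [Finset.sum_comm]
    refine Finset.sum_congr rfl fun s _ => ?_
    rw [Finset.sum_comm]
    exact Finset.sum_congr rfl fun _ _ => Finset.sum_congr rfl fun _ _ => by ring
  rw [h1, ← Finset.sum_add_distrib]
  refine Finset.sum_congr rfl fun s _ => ?_
  rw [← Finset.add_sum_erase _ _ (Finset.mem_univ s),
    ← Finset.add_sum_erase (Finset.univ) (fun s' => if s = s' then 0 else _) (Finset.mem_univ s)]
  simp only [if_true, zero_add]
  congr 1
  · simp only [sq]; ring
  · refine Finset.sum_congr rfl fun s' hs' => ?_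
    rw [if_neg (Finset.ne_of_mem_erase hs').symm]

lemma expect_exp_decoupled_le (W : α → α → ℝ) (K : ℝ)
    (hK : ∀ b : α → Bool, 𝔼 σ : α → Bool, Real.exp (∑ t, (∑ s, (Real.sqrt 8 *
      (if cosel b t then (if b s then W s t else 0) else 0)) * sg σ s) ^ 2) ≤ K) :
    𝔼 σ : α → Bool, Real.exp (∑ s, ∑ t, (if s = t then 0 else W s t * sg σ s * sg σ t)) ≤ K := by
  refine (expect_exp_offdiag_le W).trans ?_
  refine Finset.expect_le Finset.univ_nonempty fun b _ => ?_
  refine le_trans (le_of_eq ?_) (hK b)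
  refine Finset.expect_congr rfl fun σ _ => ?_
  congr 1
  rw [Finset.mul_sum]
  refine Finset.sum_congr rfl fun t _ => ?_
  have h8 : (8 : ℝ) = Real.sqrt 8 ^ 2 := (Real.sq_sqrt (by norm_num)).symm
  nth_rewrite 1 [h8]
  rw [← mul_pow]
  congr 1
  by_cases hb : cosel b t = true
  · simp only [mask, hb, if_true, Finset.mul_sum]
    refine Finset.sum_congr rfl fun s _ => ?_
    by_cases hc : b s = true <;> simp [hc]
    ring
  · simp [mask, hb]

lemma expect_exp_sq_le_aux (j : ℕ) : ∀ (A : α → α → ℝ) (κ : ℝ), 0 ≤ κ → κ ≤ 1 / 4 → OpLe A κ →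
    𝔼 σ : α → Bool, Real.exp (∑ t, (∑ s, A t s * sg σ s) ^ 2) ≤
      Real.exp (2 * ∑ t, ∑ s, A t s ^ 2 + Fintype.card α * κ ^ 2 / 2 ^ j) := by
  induction j with
  | zero =>
    intro A κ _ _ hA
    refine Finset.expect_le Finset.univ_nonempty fun σ _ => Real.exp_le_exp.mpr ?_
    have h := hA (sg σ)
    simp only [sg_sq, Finset.sum_const, Finset.card_univ, nsmul_eq_mul, mul_one] at h
    have h0 : 0 ≤ ∑ t, ∑ s, A t s ^ 2 :=
      Finset.sum_nonneg fun _ _ => Finset.sum_nonneg fun _ _ => sq_nonneg _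
    rw [pow_zero, div_one]; linarith
  | succ j ih =>
    intro A κ h0 h1 hA
    set F := ∑ t, ∑ s, A t s ^ 2 with hF
    have hF0 : 0 ≤ F := Finset.sum_nonneg fun _ _ => Finset.sum_nonneg fun _ _ => sq_nonneg _
    set M : α → α → ℝ := fun s s' => ∑ t, A t s * A t s' with hM
    have hMop : OpLe M (κ * κ) := by
      have := hA.transpose.comp hA
      simpa [hM] using this
    have hMF : ∑ s, ∑ s', M s' s ^ 2 ≤ κ ^ 2 * F := by
      rw [hF, Finset.sum_comm (f := fun t s => A t s ^ 2), Finset.mul_sum]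
      refine Finset.sum_le_sum fun s _ => ?_
      exact hA.transpose (fun t => A t s)
    have hMsymm : ∀ s s', M s s' = M s' s := fun s s' => by simp [hM, mul_comm]
    have h8 : Real.sqrt 8 ^ 2 = 8 := Real.sq_sqrt (by norm_num)
    have h8' : Real.sqrt 8 ≤ 3 := by
      rw [Real.sqrt_le_left (by norm_num)]; norm_num
    have h8'' : 0 ≤ Real.sqrt 8 := Real.sqrt_nonneg 8
    have hdiag : ∀ σ : α → Bool, Real.exp (∑ t, (∑ s, A t s * sg σ s) ^ 2) = Real.exp F *
        Real.exp (∑ s, ∑ t, (if s = t then 0 else M s t * sg σ s * sg σ t)) := by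
      intro σ
      rw [sum_sq_mulVec_eq, Real.exp_add]
      simp only [sg_sq, mul_one]
      rw [Finset.sum_comm]
    simp only [hdiag, ← Finset.mul_expect]
    have hdec : 𝔼 σ : α → Bool, Real.exp (∑ s, ∑ t,
        (if s = t then 0 else M s t * sg σ s * sg σ t)) ≤
        Real.exp (F + Fintype.card α * κ ^ 2 / 2 ^ (j + 1)) := by
      refine expect_exp_decoupled_le M _ fun b => ?_
      have hop := OpLe.mask_smul (A := fun t s => M s t) hMop.transpose (cosel b) b (Real.sqrt 8)
      have hκ : Real.sqrt 8 * (κ * κ) ≤ 1 / 4 := by nlinarith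
      refine (ih _ _ (by positivity) hκ hop).trans (Real.exp_le_exp.mpr ?_)
      have hfr := sum_sum_mask_sq_le (fun t s => M s t) (cosel b) b (Real.sqrt 8)
      rw [h8] at hfr
      have hκ2 : κ ^ 2 ≤ 1 / 16 := by nlinarith
      have e1 : (Real.sqrt 8 * (κ * κ)) ^ 2 ≤ κ ^ 2 / 2 := by
        rw [mul_pow, h8]; nlinarith [sq_nonneg κ]
      have e2 : (Fintype.card α : ℝ) * (Real.sqrt 8 * (κ * κ)) ^ 2 / 2 ^ j ≤
          Fintype.card α * κ ^ 2 / 2 ^ (j + 1) := by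
        rw [pow_succ (2 : ℝ) j, mul_comm ((2 : ℝ) ^ j) 2, ← div_div]
        gcongr
        rw [mul_div_assoc]
        gcongr
      have e3 : 8 * (κ ^ 2 * F) ≤ F / 2 := by nlinarith
      linarith
    refine (mul_le_mul_of_nonneg_left hdec (Real.exp_pos F).le).trans (le_of_eq ?_)
    rw [← Real.exp_add]; ring_nf

lemma expect_exp_sq_le (A : α → α → ℝ) (κ : ℝ) (h0 : 0 ≤ κ) (h1 : κ ≤ 1 / 4) (hA : OpLe A κ) :
    𝔼 σ : α → Bool, Real.exp (∑ t, (∑ s, A t s * sg σ s) ^ 2) ≤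
      Real.exp (2 * ∑ t, ∑ s, A t s ^ 2) := by
  refine ge_of_tendsto' (x := Filter.atTop) (f := fun j : ℕ => Real.exp
    (2 * ∑ t, ∑ s, A t s ^ 2 + Fintype.card α * κ ^ 2 / 2 ^ j)) ?_
    (fun j => expect_exp_sq_le_aux j A κ h0 h1 hA)
  refine (Real.continuous_exp.tendsto _).comp ?_
  have h2 : Filter.Tendsto (fun j : ℕ => (Fintype.card α : ℝ) * κ ^ 2 / 2 ^ j)
      Filter.atTop (nhds 0) :=
    tendsto_const_nhds.div_atTop (tendsto_pow_atTop_atTop_of_one_lt (by norm_num))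
  simpa using h2.const_add (2 * ∑ t, ∑ s, A t s ^ 2)

/-- Hanson–Wright type bound for the moment generating function of an off-diagonal
Rademacher chaos. -/
lemma expect_exp_chaos_le (W : α → α → ℝ) (κ : ℝ) (h0 : 0 ≤ κ) (h1 : κ ≤ 1 / 12)
    (hW : OpLe W κ) :
    𝔼 σ : α → Bool, Real.exp (∑ s, ∑ t, (if s = t then 0 else W s t * sg σ s * sg σ t)) ≤
      Real.exp (16 * ∑ s, ∑ t, W s t ^ 2) := by
  refine expect_exp_decoupled_le W _ fun b => ?_
  have h8 : Real.sqrt 8 ^ 2 = 8 := Real.sq_sqrt (by norm_num)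
  have h8' : Real.sqrt 8 ≤ 3 := by
    rw [Real.sqrt_le_left (by norm_num)]; norm_num
  have h8'' : 0 ≤ Real.sqrt 8 := Real.sqrt_nonneg 8
  have hop := OpLe.mask_smul (A := fun t s => W s t) hW.transpose (cosel b) b (Real.sqrt 8)
  refine (expect_exp_sq_le _ _ (by positivity) (by nlinarith) hop).trans
    (Real.exp_le_exp.mpr ?_)
  have hfr := sum_sum_mask_sq_le (fun t s => W s t) (cosel b) b (Real.sqrt 8)
  rw [h8, Finset.sum_comm (f := fun t s => W s t ^ 2)] at hfr
  linarith

end Chaos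

section Chaining

variable {α β ι : Type*} [Fintype α] [Fintype β] [Fintype ι]

/-- Euclidean norm on a finite index type. -/
def nm (a : β → ℝ) : ℝ := Real.sqrt (∑ t, a t ^ 2)

/-- Application of a matrix to a vector. -/
def ap (A : β → α → ℝ) (a : α → ℝ) : β → ℝ := fun t => ∑ s, A t s * a s

lemma nm_nonneg (a : β → ℝ) : 0 ≤ nm a := Real.sqrt_nonneg _

lemma nm_sq (a : β → ℝ) : nm a ^ 2 = ∑ t, a t ^ 2 :=
  Real.sq_sqrt (Finset.sum_nonneg fun _ _ => sq_nonneg _)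

lemma nm_le_iff (a : β → ℝ) {c : ℝ} (hc : 0 ≤ c) : nm a ≤ c ↔ ∑ t, a t ^ 2 ≤ c ^ 2 := by
  rw [nm, Real.sqrt_le_left hc]

lemma abs_inner_le (a b : β → ℝ) : |∑ t, a t * b t| ≤ nm a * nm b := by
  refine abs_le_of_sq_le_sq ?_ (mul_nonneg (nm_nonneg a) (nm_nonneg b))
  rw [mul_pow, nm_sq, nm_sq]
  exact Finset.sum_mul_sq_le_sq_mul_sq _ _ _

lemma nm_add_le (a b : β → ℝ) : nm (a + b) ≤ nm a + nm b := by
  rw [nm_le_iff _ (add_nonneg (nm_nonneg a) (nm_nonneg b))]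
  have h := (abs_le.mp (abs_inner_le a b)).2
  have h2 : ∑ t, (a + b) t ^ 2 = ∑ t, a t ^ 2 + 2 * (∑ t, a t * b t) + ∑ t, b t ^ 2 := by
    rw [Finset.mul_sum, ← Finset.sum_add_distrib, ← Finset.sum_add_distrib]
    exact Finset.sum_congr rfl fun t _ => by simp only [Pi.add_apply]; ring
  rw [h2, ← nm_sq, ← nm_sq]
  nlinarith

lemma nm_smul (c : ℝ) (a : β → ℝ) : nm (c • a) = |c| * nm a := by
  unfold nm
  simp only [Pi.smul_apply, smul_eq_mul, mul_pow, ← Finset.mul_sum]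
  rw [Real.sqrt_mul (sq_nonneg c), Real.sqrt_sq_eq_abs]

lemma nm_sub_le (a b : β → ℝ) : nm (a - b) ≤ nm a + nm b := by
  have h := nm_add_le a ((-1 : ℝ) • b)
  rw [nm_smul] at h
  simpa [sub_eq_add_neg] using h

lemma nm_sg (σ : α → Bool) : nm (sg σ) = Real.sqrt (Fintype.card α) := by
  simp [nm, sg_sq]

lemma nm_mask_le (b : α → Bool) (a : α → ℝ) : nm (mask b a) ≤ nm a :=
  Real.sqrt_le_sqrt (sum_mask_sq_le b a)

lemma OpLe.nm_le {A : β → α → ℝ} {κ : ℝ} (h : OpLe A κ) (hκ : 0 ≤ κ) (a : α → ℝ) :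
    nm (ap A a) ≤ κ * nm a := by
  rw [nm_le_iff _ (mul_nonneg hκ (nm_nonneg a)), mul_pow, nm_sq]
  exact h a

lemma opLe_of_nm_le {A : β → α → ℝ} {κ : ℝ}
    (h : ∀ a, nm (ap A a) ≤ κ * nm a) : OpLe A κ := by
  intro a
  have := pow_le_pow_left₀ (nm_nonneg _) (h a) 2
  rwa [mul_pow, nm_sq, nm_sq] at this

lemma ap_sub_left (A B : β → α → ℝ) (a : α → ℝ) : ap (A - B) a = ap A a - ap B a := by
  funext t; simp [ap, sub_mul, Finset.sum_sub_distrib]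

lemma ap_add_right (A : β → α → ℝ) (a b : α → ℝ) : ap A (a + b) = ap A a + ap A b := by
  funext t; simp [ap, mul_add, Finset.sum_add_distrib]

lemma ap_smul_right (A : β → α → ℝ) (c : ℝ) (a : α → ℝ) : ap A (c • a) = c • ap A a := by
  funext t; simp only [ap, Pi.smul_apply, smul_eq_mul, Finset.mul_sum]
  exact Finset.sum_congr rfl fun s _ => by ring

lemma OpLe.sub {A B : β → α → ℝ} {κ μ : ℝ} (hA : OpLe A κ) (hB : OpLe B μ) (hκ : 0 ≤ κ)
    (hμ : 0 ≤ μ) : OpLe (A - B) (κ + μ) := by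
  refine opLe_of_nm_le fun a => ?_
  rw [ap_sub_left, add_mul]
  exact (nm_sub_le _ _).trans (add_le_add (hA.nm_le hκ a) (hB.nm_le hμ a))

/-- Supremum of the norms of the images of a vector under a finite family of matrices. -/
def supNm (Γ : ι → β → α → ℝ) (a : α → ℝ) : ℝ := ⨆ i, nm (ap (Γ i) a)

lemma le_supNm (Γ : ι → β → α → ℝ) (a : α → ℝ) (i : ι) : nm (ap (Γ i) a) ≤ supNm Γ a :=
  le_ciSup (f := fun i => nm (ap (Γ i) a)) (Set.finite_range _).bddAbove i

lemma supNm_nonneg (Γ : ι → β → α → ℝ) (a : α → ℝ) : 0 ≤ supNm Γ a :=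
  Real.iSup_nonneg fun _ => nm_nonneg _

lemma supNm_add_le [Nonempty ι] (Γ : ι → β → α → ℝ) (a b : α → ℝ) :
    supNm Γ (a + b) ≤ supNm Γ a + supNm Γ b := by
  refine ciSup_le fun i => ?_
  rw [ap_add_right]
  exact (nm_add_le _ _).trans (add_le_add (le_supNm Γ a i) (le_supNm Γ b i))

lemma supNm_smul_le [Nonempty ι] (Γ : ι → β → α → ℝ) (c : ℝ) (a : α → ℝ) :
    supNm Γ (c • a) ≤ |c| * supNm Γ a := by
  refine ciSup_le fun i => ?_
  rw [ap_smul_right, nm_smul]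
  exact mul_le_mul_of_nonneg_left (le_supNm Γ a i) (abs_nonneg c)

variable [DecidableEq α]

lemma expect_supNm_mask_le [Nonempty ι] (Γ : ι → β → α → ℝ) (b : α → Bool) :
    𝔼 σ : α → Bool, supNm Γ (mask b (sg σ)) ≤ 𝔼 σ : α → Bool, supNm Γ (sg σ) := by
  have hinv : Function.Involutive
      (fun σ : α → Bool => fun t => if b t then σ t else !σ t) := by
    intro σ; funext t; by_cases h : b t <;> simp [h]
  have h1 : 𝔼 σ : α → Bool, supNm Γ (sg (fun t => if b t then σ t else !σ t)) =
      𝔼 σ : α → Bool, supNm Γ (sg σ) :=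
    Fintype.expect_equiv hinv.toPerm _ _ fun _ => rfl
  have h2 : ∀ σ : α → Bool, supNm Γ (mask b (sg σ)) ≤
      (supNm Γ (sg σ) + supNm Γ (sg (fun t => if b t then σ t else !σ t))) / 2 := by
    intro σ
    have e : mask b (sg σ) =
        (1 / 2 : ℝ) • (sg σ + sg (fun t => if b t then σ t else !σ t)) := by
      funext t
      by_cases h : b t = true
      · simp [mask, sg, h]; ring
      · by_cases h' : σ t = true <;> simp [mask, sg, rsign, h, h']
    rw [e]
    refine (supNm_smul_le _ _ _).trans ?_
    have := supNm_add_le Γ (sg σ) (sg (fun t => if b t then σ t else !σ t))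
    rw [abs_of_pos (by norm_num)]; linarith
  refine (Finset.expect_le_expect fun σ _ => h2 σ).trans (le_of_eq ?_)
  rw [← Finset.expect_div, Finset.expect_add_distrib, h1]
  ring

lemma expect_abs_linear_le {κ : Type*} (s : Finset κ) (sel : (α → Bool) → κ)
    (hsel : ∀ σ, sel σ ∈ s) (Δ : κ → β → α → ℝ) (y : κ → β → ℝ) (b : α → Bool) (W r N : ℝ)
    (hW : 0 ≤ W) (hr : 0 ≤ r) (hN : 1 ≤ N) (hsN : (s.card : ℝ) ≤ N)
    (hΔ : ∀ q ∈ s, OpLe (Δ q) W) (hy : ∀ q ∈ s, nm (y q) ≤ r) :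
    𝔼 τ : α → Bool, |∑ t, y (sel τ) t * ap (Δ (sel τ)) (mask b (sg τ)) t| ≤
      W * r * Real.sqrt (2 * Real.log (2 * N)) := by
  have h := expect_abs_selector_le s sel hsel
    (fun q => mask b (fun u => ∑ t, Δ q t u * y q t)) (W * r) N (mul_nonneg hW hr) hN hsN ?_
  · refine le_trans (le_of_eq ?_) h
    refine Finset.expect_congr rfl fun τ _ => ?_
    congr 1
    simp only [ap, Finset.mul_sum]
    rw [Finset.sum_comm]
    refine Finset.sum_congr rfl fun u _ => ?_
    by_cases hb : b u = true
    · simp only [mask, hb, if_true, Finset.sum_mul]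
      exact Finset.sum_congr rfl fun t _ => by ring
    · simp [mask, hb]
  · intro q hq
    refine (sum_mask_sq_le _ _).trans (((hΔ q hq).transpose (y q)).trans ?_)
    rw [mul_pow]
    refine mul_le_mul_of_nonneg_left ?_ (sq_nonneg W)
    exact (nm_le_iff _ hr).mp (hy q hq)

variable [DecidableEq ι]

/-- The data of a chain of finite approximations for a family of matrices. -/
structure Chain (Γ : ι → β → α → ℝ) (J : ℕ) (π : ℕ → ι → ι) (N w : ℕ → ℝ) (i₀ : ι) : Prop where
  one_le : ∀ l, 1 ≤ N l
  nonneg : ∀ l, 0 ≤ w l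
  card_le : ∀ l, ((Finset.univ.image (π l)).card : ℝ) ≤ N l
  op_le : ∀ l i, OpLe (Γ i - Γ (π l i)) (w l)
  start : ∀ i, π 0 i = i₀
  zero : Γ i₀ = 0

/-- The entropy sum attached to a chain. -/
def chainSum (n : ℝ) (J : ℕ) (N w : ℕ → ℝ) : ℝ :=
  2 * ∑ l ∈ Finset.range J, (w l + w (l + 1)) * Real.sqrt (2 * Real.log (2 * (N l * N (l + 1))))
    + 2 * w J * Real.sqrt n

variable {Γ : ι → β → α → ℝ} {J : ℕ} {π : ℕ → ι → ι} {N w : ℕ → ℝ} {i₀ : ι}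

lemma Chain.expect_decoupled_le (h : Chain Γ J π N w i₀) (b : α → Bool)
    (sel : (α → Bool) → (α → Bool) → ι) :
    𝔼 σ : α → Bool, 𝔼 τ : α → Bool, |∑ t, ap (Γ (sel σ τ)) (mask b (sg σ)) t *
        ap (Γ (sel σ τ)) (mask (cosel b) (sg τ)) t| ≤
      chainSum (Fintype.card α) J N w * 𝔼 σ : α → Bool, supNm Γ (sg σ) := by
  have : Nonempty ι := ⟨i₀⟩
  set ER := 𝔼 σ : α → Bool, supNm Γ (sg σ) with hER
  set Z : ι → (α → ℝ) → (α → ℝ) → ℝ := fun i a c => ∑ t, ap (Γ i) a t * ap (Γ i) c t with hZ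
  set q : ℕ → ℝ := fun l => Real.sqrt (2 * Real.log (2 * (N l * N (l + 1)))) with hq
  let U : ℕ → ι → (α → ℝ) → (α → ℝ) → ℝ := fun l i a c =>
    ∑ t, ap (Γ (π (l + 1) i)) a t * ap (Γ (π (l + 1) i) - Γ (π l i)) c t
  let V : ℕ → ι → (α → ℝ) → (α → ℝ) → ℝ := fun l i a c =>
    ∑ t, ap (Γ (π l i)) c t * ap (Γ (π (l + 1) i) - Γ (π l i)) a t
  have hstep : ∀ l i a c, Z (π (l + 1) i) a c - Z (π l i) a c = U l i a c + V l i a c := by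
    intro l i a c
    simp only [hZ, U, V, ap_sub_left, ← Finset.sum_sub_distrib, ← Finset.sum_add_distrib]
    exact Finset.sum_congr rfl fun t _ => by simp only [Pi.sub_apply]; ring
  have htel : ∀ i a c, Z (π J i) a c = ∑ l ∈ Finset.range J, (U l i a c + V l i a c) := by
    intro i a c
    have h0 : Z (π 0 i) a c = 0 := by simp [hZ, h.start, h.zero, ap]
    simp only [← hstep]
    rw [Finset.sum_range_sub (fun l => Z (π l i) a c), h0, sub_zero]
  have hlast : ∀ i a c, |Z i a c - Z (π J i) a c| ≤
      w J * (supNm Γ a * nm c + supNm Γ c * nm a) := by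
    intro i a c
    have e : Z i a c - Z (π J i) a c = ∑ t, ap (Γ i) a t * ap (Γ i - Γ (π J i)) c t +
        ∑ t, ap (Γ (π J i)) c t * ap (Γ i - Γ (π J i)) a t := by
      simp only [hZ, ap_sub_left, ← Finset.sum_sub_distrib, ← Finset.sum_add_distrib]
      exact Finset.sum_congr rfl fun t _ => by simp only [Pi.sub_apply]; ring
    rw [e]
    refine (abs_add_le _ _).trans ?_
    have e1 := (abs_inner_le (ap (Γ i) a) (ap (Γ i - Γ (π J i)) c)).trans
      (mul_le_mul (le_supNm Γ a i) ((h.op_le J i).nm_le (h.nonneg J) c) (nm_nonneg _)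
        (supNm_nonneg Γ a))
    have e2 := (abs_inner_le (ap (Γ (π J i)) c) (ap (Γ i - Γ (π J i)) a)).trans
      (mul_le_mul (le_supNm Γ c (π J i)) ((h.op_le J i).nm_le (h.nonneg J) a) (nm_nonneg _)
        (supNm_nonneg Γ c))
    linarith
  have hpt : ∀ i (σ τ : α → Bool), |Z i (mask b (sg σ)) (mask (cosel b) (sg τ))| ≤
      ∑ l ∈ Finset.range J, (|U l i (mask b (sg σ)) (mask (cosel b) (sg τ))| +
        |V l i (mask b (sg σ)) (mask (cosel b) (sg τ))|) +
      w J * Real.sqrt (Fintype.card α) *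
        (supNm Γ (mask b (sg σ)) + supNm Γ (mask (cosel b) (sg τ))) := by
    intro i σ τ
    set a := mask b (sg σ)
    set c := mask (cosel b) (sg τ)
    have ha : nm a ≤ Real.sqrt (Fintype.card α) := (nm_mask_le _ _).trans (nm_sg σ).le
    have hc : nm c ≤ Real.sqrt (Fintype.card α) := (nm_mask_le _ _).trans (nm_sg τ).le
    have e1 : |Z i a c| ≤ |Z (π J i) a c| + |Z i a c - Z (π J i) a c| := by
      have := abs_add_le (Z (π J i) a c) (Z i a c - Z (π J i) a c)
      simpa using this
    have e2 : |Z (π J i) a c| ≤ ∑ l ∈ Finset.range J, (|U l i a c| + |V l i a c|) := by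
      rw [htel]
      exact (Finset.abs_sum_le_sum_abs _ _).trans (Finset.sum_le_sum fun l _ => abs_add_le _ _)
    have e3 : w J * (supNm Γ a * nm c + supNm Γ c * nm a) ≤
        w J * Real.sqrt (Fintype.card α) * (supNm Γ a + supNm Γ c) := by
      rw [mul_assoc]
      refine mul_le_mul_of_nonneg_left ?_ (h.nonneg J)
      have := mul_le_mul_of_nonneg_left hc (supNm_nonneg Γ a)
      have := mul_le_mul_of_nonneg_left ha (supNm_nonneg Γ c)
      linarith
    have := hlast i a c
    linarith
  have hcard : ∀ l, (((Finset.univ.image fun i => (π (l + 1) i, π l i)).card : ℕ) : ℝ) ≤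
      N l * N (l + 1) := by
    intro l
    have hsub : (Finset.univ.image fun i => (π (l + 1) i, π l i)) ⊆
        (Finset.univ.image (π (l + 1))) ×ˢ (Finset.univ.image (π l)) := by
      intro x hx
      obtain ⟨i, _, rfl⟩ := Finset.mem_image.mp hx
      simp
    have h1 := Finset.card_le_card hsub
    rw [Finset.card_product] at h1
    calc _ ≤ (((Finset.univ.image (π (l + 1))).card * (Finset.univ.image (π l)).card : ℕ) : ℝ) := by
          exact_mod_cast h1
      _ ≤ N (l + 1) * N l := by
          push_cast
          exact mul_le_mul (h.card_le _) (h.card_le _) (Nat.cast_nonneg _)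
            (zero_le_one.trans (h.one_le _))
      _ = _ := mul_comm _ _
  have hNN : ∀ l, 1 ≤ N l * N (l + 1) := fun l => one_le_mul_of_one_le_of_one_le (h.one_le _)
    (h.one_le _)
  have hop : ∀ l, ∀ x ∈ (Finset.univ.image fun i => (π (l + 1) i, π l i)),
      OpLe (Γ x.1 - Γ x.2) (w l + w (l + 1)) := by
    intro l x hx
    obtain ⟨i, _, rfl⟩ := Finset.mem_image.mp hx
    have := (h.op_le l i).sub (h.op_le (l + 1) i) (h.nonneg l) (h.nonneg _)
    simpa using this
  have hU : ∀ l, 𝔼 σ : α → Bool, 𝔼 τ : α → Bool,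
      |U l (sel σ τ) (mask b (sg σ)) (mask (cosel b) (sg τ))| ≤
        (w l + w (l + 1)) * q l * ER := by
    intro l
    calc _ ≤ 𝔼 σ : α → Bool, (w l + w (l + 1)) * supNm Γ (mask b (sg σ)) * q l := by
          refine Finset.expect_le_expect fun σ _ => ?_
          exact expect_abs_linear_le (Finset.univ.image fun i => (π (l + 1) i, π l i))
            (fun τ => (π (l + 1) (sel σ τ), π l (sel σ τ)))
            (fun τ => Finset.mem_image_of_mem _ (Finset.mem_univ _))
            (fun x => Γ x.1 - Γ x.2) (fun x => ap (Γ x.1) (mask b (sg σ))) (cosel b) _ _ _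
            (add_nonneg (h.nonneg _) (h.nonneg _)) (supNm_nonneg _ _) (hNN l) (hcard l)
            (hop l) (fun x _ => le_supNm Γ _ _)
      _ = (w l + w (l + 1)) * q l * 𝔼 σ : α → Bool, supNm Γ (mask b (sg σ)) := by
          rw [Finset.mul_expect]; exact Finset.expect_congr rfl fun _ _ => by ring
      _ ≤ _ := mul_le_mul_of_nonneg_left (expect_supNm_mask_le Γ b)
          (mul_nonneg (add_nonneg (h.nonneg _) (h.nonneg _)) (Real.sqrt_nonneg _))
  have hV : ∀ l, 𝔼 σ : α → Bool, 𝔼 τ : α → Bool,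
      |V l (sel σ τ) (mask b (sg σ)) (mask (cosel b) (sg τ))| ≤
        (w l + w (l + 1)) * q l * ER := by
    intro l
    rw [Finset.expect_comm]
    calc _ ≤ 𝔼 τ : α → Bool, (w l + w (l + 1)) * supNm Γ (mask (cosel b) (sg τ)) * q l := by
          refine Finset.expect_le_expect fun τ _ => ?_
          exact expect_abs_linear_le (Finset.univ.image fun i => (π (l + 1) i, π l i))
            (fun σ => (π (l + 1) (sel σ τ), π l (sel σ τ)))
            (fun σ => Finset.mem_image_of_mem _ (Finset.mem_univ _))
            (fun x => Γ x.1 - Γ x.2) (fun x => ap (Γ x.2) (mask (cosel b) (sg τ))) b _ _ _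
            (add_nonneg (h.nonneg _) (h.nonneg _)) (supNm_nonneg _ _) (hNN l) (hcard l)
            (hop l) (fun x _ => le_supNm Γ _ _)
      _ = (w l + w (l + 1)) * q l * 𝔼 σ : α → Bool, supNm Γ (mask (cosel b) (sg σ)) := by
          rw [Finset.mul_expect]; exact Finset.expect_congr rfl fun _ _ => by ring
      _ ≤ _ := mul_le_mul_of_nonneg_left (expect_supNm_mask_le Γ (cosel b))
          (mul_nonneg (add_nonneg (h.nonneg _) (h.nonneg _)) (Real.sqrt_nonneg _))
  refine (Finset.expect_le_expect fun σ _ => Finset.expect_le_expect fun τ _ =>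
    hpt (sel σ τ) σ τ).trans ?_
  simp only [Finset.expect_add_distrib, Finset.expect_sum_comm, ← Finset.mul_expect,
    Fintype.expect_const]
  have hsum : ∑ l ∈ Finset.range J, (𝔼 σ : α → Bool, 𝔼 τ : α → Bool,
      |U l (sel σ τ) (mask b (sg σ)) (mask (cosel b) (sg τ))| + 𝔼 σ : α → Bool, 𝔼 τ : α → Bool,
      |V l (sel σ τ) (mask b (sg σ)) (mask (cosel b) (sg τ))|) ≤
      ∑ l ∈ Finset.range J, ((w l + w (l + 1)) * q l) * (2 * ER) :=
    Finset.sum_le_sum fun l _ => by have := hU l; have := hV l; linarith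
  rw [← Finset.sum_mul] at hsum
  have hw : 0 ≤ w J * Real.sqrt (Fintype.card α) := mul_nonneg (h.nonneg J) (Real.sqrt_nonneg _)
  have h3 := mul_le_mul_of_nonneg_left
    (add_le_add (expect_supNm_mask_le Γ b) (expect_supNm_mask_le Γ (cosel b))) hw
  rw [chainSum]
  refine (add_le_add hsum h3).trans (le_of_eq ?_)
  ring

/-- Chaining bound for the supremum of a second-order Rademacher chaos. -/
theorem Chain.expect_chaos_le (h : Chain Γ J π N w i₀) (sel : (α → Bool) → ι) :
    𝔼 σ : α → Bool, |∑ t, ap (Γ (sel σ)) (sg σ) t ^ 2 - ∑ t, ∑ s, Γ (sel σ) t s ^ 2| ≤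
      4 * (chainSum (Fintype.card α) J N w * 𝔼 σ : α → Bool, supNm Γ (sg σ)) := by
  have : Nonempty ι := ⟨i₀⟩
  set Z : ι → (α → ℝ) → (α → ℝ) → ℝ := fun i a c => ∑ t, ap (Γ i) a t * ap (Γ i) c t with hZ
  have hmax : ∀ a c : α → ℝ, ∃ i, ∀ j, |Z j a c| ≤ |Z i a c| := fun a c =>
    Finite.exists_max fun i => |Z i a c|
  choose m hm using hmax
  have h1 : ∀ σ : α → Bool, |∑ t, ap (Γ (sel σ)) (sg σ) t ^ 2 - ∑ t, ∑ s, Γ (sel σ) t s ^ 2| ≤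
      4 * 𝔼 b : α → Bool, |Z (m (mask b (sg σ)) (mask (cosel b) (sg σ)))
        (mask b (sg σ)) (mask (cosel b) (sg σ))| := by
    intro σ
    have e1 := sum_sq_mulVec_eq (Γ (sel σ)) (sg σ)
    simp only [sg_sq, mul_one] at e1
    rw [Finset.sum_comm (f := fun s t => Γ (sel σ) t s ^ 2)] at e1
    have e2 : ∑ t, ap (Γ (sel σ)) (sg σ) t ^ 2 - ∑ t, ∑ s, Γ (sel σ) t s ^ 2 =
        4 * 𝔼 b : α → Bool, Z (sel σ) (mask b (sg σ)) (mask (cosel b) (sg σ)) := by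
      simp only [ap]
      rw [e1, add_sub_cancel_left, offdiag_eq]
      congr 1
      refine Finset.expect_congr rfl fun b _ => ?_
      simp only [hZ, ap, Finset.sum_mul_sum]
      symm
      rw [Finset.sum_comm]
      refine Finset.sum_congr rfl fun s _ => ?_
      rw [Finset.sum_comm]
      refine Finset.sum_congr rfl fun s' _ => ?_
      simp only [Finset.sum_mul]
      exact Finset.sum_congr rfl fun _ _ => by ring
    rw [e2, abs_mul, abs_of_pos (by norm_num : (0 : ℝ) < 4)]
    refine mul_le_mul_of_nonneg_left ((Finset.abs_expect_le _ _).trans ?_) (by norm_num)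
    exact Finset.expect_le_expect fun b _ => hm _ _ _
  refine (Finset.expect_le_expect fun σ _ => h1 σ).trans ?_
  rw [← Finset.mul_expect, Finset.expect_comm]
  refine mul_le_mul_of_nonneg_left ?_ (by norm_num)
  refine Finset.expect_le Finset.univ_nonempty fun b _ => ?_
  rw [expect_mask_indep b (fun a c => |Z (m a c) a c|)]
  exact h.expect_decoupled_le b (fun σ τ => m (mask b (sg σ)) (mask (cosel b) (sg τ)))

end Chaining

section Fourier

variable {G : Type*} [AddCommGroup G] [Fintype G] [DecidableEq G]

/-- Fourier transform of a real function on a finite abelian group. -/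
def ft (y : G → ℝ) (ψ : AddChar G ℂ) : ℂ := ∑ t, (y t : ℂ) * ψ t

lemma sum_norm_ft_sq (y : G → ℝ) :
    ∑ ψ : AddChar G ℂ, ‖ft y ψ‖ ^ 2 = Fintype.card G * ∑ t, y t ^ 2 := by
  have h : ((∑ ψ : AddChar G ℂ, ‖ft y ψ‖ ^ 2 : ℝ) : ℂ) =
      ((Fintype.card G * ∑ t, y t ^ 2 : ℝ) : ℂ) := by
    push_cast
    have h1 : ∀ ψ : AddChar G ℂ, (‖ft y ψ‖ : ℂ) ^ 2 =
        ∑ t, ∑ s, (y t : ℂ) * y s * ψ (t - s) := by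
      intro ψ
      rw [← Complex.mul_conj', ft, map_sum, Finset.sum_mul_sum]
      refine Finset.sum_congr rfl fun t _ => Finset.sum_congr rfl fun s _ => ?_
      rw [map_mul, Complex.conj_ofReal, ← AddChar.map_neg_eq_conj, sub_eq_add_neg,
        AddChar.map_add_eq_mul]
      ring
    simp only [h1]
    rw [Finset.sum_comm, Finset.mul_sum]
    refine Finset.sum_congr rfl fun t _ => ?_
    rw [Finset.sum_comm]
    simp only [← Finset.mul_sum, AddChar.sum_apply_eq_ite, sub_eq_zero]
    simp
    ring
  exact_mod_cast h

lemma ft_conv (y z : G → ℝ) (ψ : AddChar G ℂ) :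
    ft (fun j => ∑ s, y (j - s) * z s) ψ = ft y ψ * ft z ψ := by
  simp only [ft, Finset.sum_mul_sum]
  push_cast
  simp only [Finset.sum_mul]
  rw [Finset.sum_comm]
  conv_rhs => rw [Finset.sum_comm]
  refine Finset.sum_congr rfl fun s _ => ?_
  refine Fintype.sum_equiv (Equiv.subRight s) _ _ fun j => ?_
  have : ψ j = ψ (j - s) * ψ s := by rw [← AddChar.map_add_eq_mul, sub_add_cancel]
  simp only [Equiv.subRight_apply, this]
  ring

lemma ft_sub (y z : G → ℝ) (ψ : AddChar G ℂ) : ft (y - z) ψ = ft y ψ - ft z ψ := by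
  simp [ft, sub_mul, Finset.sum_sub_distrib]

lemma ft_comp_neg (y : G → ℝ) (ψ : AddChar G ℂ) :
    ft (fun t => y (-t)) ψ = (starRingEnd ℂ) (ft y ψ) := by
  simp only [ft, map_sum, map_mul, Complex.conj_ofReal]
  refine Fintype.sum_equiv (Equiv.neg G) _ _ fun t => ?_
  simp [← AddChar.map_neg_eq_conj]

lemma norm_ft_le (y : G → ℝ) (ψ : AddChar G ℂ) : ‖ft y ψ‖ ≤ ∑ t, |y t| := by
  refine (norm_sum_le _ _).trans (Finset.sum_le_sum fun t _ => ?_)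
  simp

/-- A convolution operator is bounded by the sup norm of the Fourier transform of its kernel. -/
lemma opLe_circulant (y : G → ℝ) (U : ℝ) (h : ∀ ψ : AddChar G ℂ, ‖ft y ψ‖ ≤ U) :
    OpLe (fun j s => y (j - s)) U := by
  intro z
  have hn : (0 : ℝ) < Fintype.card G := by exact_mod_cast Fintype.card_pos
  refine le_of_mul_le_mul_left ?_ hn
  rw [← sum_norm_ft_sq (fun j => ∑ s, y (j - s) * z s), mul_left_comm, ← sum_norm_ft_sq,
    Finset.mul_sum]
  refine Finset.sum_le_sum fun ψ _ => ?_
  rw [ft_conv, norm_mul, mul_pow]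
  exact mul_le_mul_of_nonneg_right (pow_le_pow_left₀ (norm_nonneg _) (h ψ) 2) (sq_nonneg _)

lemma card_mul_sum_correlation_sq (b y : G → ℝ) :
    Fintype.card G * ∑ s, (∑ j, b j * y (j - s)) ^ 2 =
      ∑ ψ : AddChar G ℂ, ‖ft y ψ‖ ^ 2 * ‖ft b ψ‖ ^ 2 := by
  have e : (fun s => ∑ j, b j * y (j - s)) =
      fun s => ∑ j, (fun t => y (-t)) (s - j) * b j := by
    funext s; exact Finset.sum_congr rfl fun j _ => by simp [mul_comm]
  have := sum_norm_ft_sq (fun s => ∑ j, b j * y (j - s))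
  rw [← this, e]
  refine Finset.sum_congr rfl fun ψ _ => ?_
  rw [ft_conv (fun t => y (-t)) b, ft_comp_neg, norm_mul, mul_pow, RCLike.norm_conj]

end Fourier

section Maurey

variable {G κ : Type*} [Fintype G] [Fintype κ]

lemma exists_atom (φ : κ → G → ℝ) (hφ : ∀ q t, |φ q t| ≤ 1) (y : G → ℝ) {L : ℝ} (hL : 0 < L)
    (hy : ∑ t, |y t| ≤ L) (η : ℝ) (c : κ → ℝ) (hc : ∀ q, 0 ≤ c q) [Nonempty G] :
    ∃ a : G × Bool, ∑ q, c q * Real.exp (η * (∑ t, y t * φ q t - L * (rsign a.2 * φ q a.1))) ≤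
      Real.exp (2 * η ^ 2 * L ^ 2) * ∑ q, c q := by
  have hn : (0 : ℝ) < Fintype.card G := by exact_mod_cast Fintype.card_pos
  set g : G → ℝ := fun t => |y t| / L + (1 - (∑ t, |y t|) / L) / Fintype.card G with hg
  set μ : G × Bool → ℝ := fun a => (g a.1 + rsign a.2 * y a.1 / L) / 2 with hμ
  have hslack : 0 ≤ (1 - (∑ t, |y t|) / L) / Fintype.card G := by
    refine div_nonneg ?_ hn.le
    rw [sub_nonneg, div_le_one hL]; exact hy
  have hμ0 : ∀ a, 0 ≤ μ a := by
    rintro ⟨t, b⟩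
    have h1 : -(|y t| / L) ≤ rsign b * y t / L := by
      rw [← neg_div]
      refine div_le_div_of_nonneg_right ?_ hL.le
      cases b <;> simp only [rsign] <;> norm_num
      · exact le_abs_self _
      · exact neg_abs_le _
    simp only [hμ, hg]
    linarith
  have hg1 : ∑ t, g t = 1 := by
    simp only [hg, Finset.sum_add_distrib, ← Finset.sum_div, Finset.sum_const, Finset.card_univ,
      nsmul_eq_mul]
    field_simp
    ring
  have hμ1 : ∑ a, μ a = 1 := by
    rw [Fintype.sum_prod_type, ← hg1]
    refine Finset.sum_congr rfl fun t _ => ?_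
    simp only [hμ, Fintype.sum_bool, rsign]
    simp
    ring
  have hmean : ∀ q, ∑ a, μ a * (rsign a.2 * φ q a.1) = (∑ t, y t * φ q t) / L := by
    intro q
    rw [Fintype.sum_prod_type, Finset.sum_div]
    refine Finset.sum_congr rfl fun t _ => ?_
    simp only [hμ, Fintype.sum_bool, rsign]
    simp
    ring
  have hfq : ∀ q, |∑ t, y t * φ q t| ≤ L := by
    intro q
    refine (Finset.abs_sum_le_sum_abs _ _).trans (le_trans (Finset.sum_le_sum fun t _ => ?_) hy)
    rw [abs_mul]
    exact mul_le_of_le_one_right (abs_nonneg _) (hφ q t)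
  have hX : ∀ q, ∑ a, μ a * Real.exp (η * (∑ t, y t * φ q t - L * (rsign a.2 * φ q a.1))) ≤
      Real.exp (2 * η ^ 2 * L ^ 2) := by
    intro q
    set f := ∑ t, y t * φ q t with hf
    have h1 : ∀ a : G × Bool, Real.exp (η * (f - L * (rsign a.2 * φ q a.1))) ≤
        Real.cosh (η * (2 * L)) +
          (f / L - rsign a.2 * φ q a.1) / 2 * Real.sinh (η * (2 * L)) := by
      intro a
      have e : η * (f - L * (rsign a.2 * φ q a.1)) =
          (f / L - rsign a.2 * φ q a.1) / 2 * (η * (2 * L)) := by field_simp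
      rw [e]
      refine Real.exp_mul_le_cosh_add_mul_sinh ?_ _
      have h2 : |f / L| ≤ 1 := by
        rw [abs_div, abs_of_pos hL, div_le_one hL]; exact hfq q
      have h3 : |rsign a.2 * φ q a.1| ≤ 1 := by
        rw [abs_mul]
        have : |rsign a.2| = 1 := by cases a.2 <;> simp [rsign]
        rw [this, one_mul]; exact hφ _ _
      rw [abs_div, abs_two, div_le_one two_pos]
      exact (abs_sub _ _).trans (by linarith)
    clear_value f
    calc _ ≤ ∑ a, μ a * (Real.cosh (η * (2 * L)) +
          (f / L - rsign a.2 * φ q a.1) / 2 * Real.sinh (η * (2 * L))) :=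
          Finset.sum_le_sum fun a _ => mul_le_mul_of_nonneg_left (h1 a) (hμ0 a)
      _ = (∑ a, μ a) * (Real.cosh (η * (2 * L)) + f / L / 2 * Real.sinh (η * (2 * L))) -
          (∑ a, μ a * (rsign a.2 * φ q a.1)) / 2 * Real.sinh (η * (2 * L)) := by
          rw [Finset.sum_mul, Finset.sum_div, Finset.sum_mul, ← Finset.sum_sub_distrib]
          exact Finset.sum_congr rfl fun a _ => by ring
      _ = Real.cosh (η * (2 * L)) := by rw [hμ1, hmean, ← hf]; ring
      _ ≤ Real.exp ((η * (2 * L)) ^ 2 / 2) := Real.cosh_le_exp_half_sq _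
      _ = _ := by congr 1; ring
  by_contra hcon
  push Not at hcon
  have h1 : ∑ a, μ a * (Real.exp (2 * η ^ 2 * L ^ 2) * ∑ q, c q) <
      ∑ a, μ a * ∑ q, c q * Real.exp (η * (∑ t, y t * φ q t - L * (rsign a.2 * φ q a.1))) := by
    obtain ⟨a₀, _, ha₀⟩ : ∃ a ∈ Finset.univ, 0 < μ a := by
      by_contra h
      push Not at h
      have := Finset.sum_nonpos h
      linarith
    exact Finset.sum_lt_sum (fun a _ => mul_le_mul_of_nonneg_left (hcon a).le (hμ0 a))
      ⟨a₀, Finset.mem_univ _, mul_lt_mul_of_pos_left (hcon a₀) ha₀⟩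
  rw [← Finset.sum_mul, hμ1, one_mul] at h1
  refine absurd h1 (not_lt.mpr ?_)
  calc _ = ∑ q, c q * ∑ a, μ a *
        Real.exp (η * (∑ t, y t * φ q t - L * (rsign a.2 * φ q a.1))) := by
        simp only [Finset.mul_sum]
        rw [Finset.sum_comm]
        exact Finset.sum_congr rfl fun _ _ => Finset.sum_congr rfl fun _ _ => by ring
    _ ≤ ∑ q, c q * Real.exp (2 * η ^ 2 * L ^ 2) :=
        Finset.sum_le_sum fun q _ => mul_le_mul_of_nonneg_left (hX q) (hc q)
    _ = _ := by rw [← Finset.sum_mul]; ring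

lemma exists_atoms (φ : κ → G → ℝ) (hφ : ∀ q t, |φ q t| ≤ 1) (y : G → ℝ) {L : ℝ} (hL : 0 < L)
    (hy : ∑ t, |y t| ≤ L) (η : ℝ) [Nonempty G] (M : ℕ) :
    ∃ a : Fin M → G × Bool, ∑ q, Real.exp (η * ∑ i, (∑ t, y t * φ q t -
        L * (rsign (a i).2 * φ q (a i).1))) ≤
      Fintype.card κ * Real.exp (M * (2 * η ^ 2 * L ^ 2)) := by
  induction M with
  | zero => exact ⟨Fin.elim0, by simp⟩
  | succ M ih =>
    obtain ⟨a, ha⟩ := ih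
    obtain ⟨a₀, ha₀⟩ := exists_atom φ hφ y hL hy η _ (fun q => (Real.exp_pos (η * ∑ i,
      (∑ t, y t * φ q t - L * (rsign (a i).2 * φ q (a i).1)))).le)
    refine ⟨Fin.cons a₀ a, ?_⟩
    simp only [Fin.sum_univ_succ, Fin.cons_zero, Fin.cons_succ, mul_add, Real.exp_add]
    calc _ ≤ _ := le_of_eq (Finset.sum_congr rfl fun q _ => mul_comm _ _)
      _ ≤ _ := ha₀
      _ ≤ _ := mul_le_mul_of_nonneg_left ha (Real.exp_pos _).le
      _ = _ := by
        rw [mul_left_comm, ← Real.exp_add]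
        congr 2
        push_cast
        ring

/-- Empirical approximation of a point of an `ℓ¹` ball, measured by bounded functionals. -/
lemma exists_approx (φ : κ → G → ℝ) (hφ : ∀ q t, |φ q t| ≤ 1) (y : G → ℝ) {L : ℝ} (hL : 0 < L)
    (hy : ∑ t, |y t| ≤ L) [Nonempty G] {M : ℕ} (hM : 0 < M) (hκ : 1 < Fintype.card κ) :
    ∃ a : Fin M → G × Bool, ∀ q, ∑ t, y t * φ q t - L / M * ∑ i, rsign (a i).2 * φ q (a i).1 ≤
      3 * L * Real.sqrt (Real.log (Fintype.card κ) / M) := by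
  have hM' : (0 : ℝ) < M := by exact_mod_cast hM
  have hκ' : (1 : ℝ) < Fintype.card κ := by exact_mod_cast hκ
  have hl : 0 < Real.log (Fintype.card κ) := Real.log_pos hκ'
  set ℓ := Real.log (Fintype.card κ) with hℓ
  set s := Real.sqrt (ℓ / M) with hs
  have hs0 : 0 < s := Real.sqrt_pos.mpr (div_pos hl hM')
  have hs2 : s ^ 2 = ℓ / M := Real.sq_sqrt (div_pos hl hM').le
  obtain ⟨a, ha⟩ := exists_atoms φ hφ y hL hy (s / L) M
  refine ⟨a, fun q => ?_⟩
  have h1 := (Finset.single_le_sum (fun q _ => (Real.exp_pos (s / L * ∑ i,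
      (∑ t, y t * φ q t - L * (rsign (a i).2 * φ q (a i).1)))).le) (Finset.mem_univ q)).trans ha
  rw [← Real.exp_log (zero_lt_one.trans hκ'), ← Real.exp_add, Real.exp_le_exp, ← hℓ] at h1
  have e : ∑ i, (∑ t, y t * φ q t - L * (rsign (a i).2 * φ q (a i).1)) =
      M * (∑ t, y t * φ q t - L / M * ∑ i, rsign (a i).2 * φ q (a i).1) := by
    rw [Finset.sum_sub_distrib, ← Finset.mul_sum]
    simp only [Finset.sum_const, Finset.card_univ, Fintype.card_fin, nsmul_eq_mul]
    field_simp
  rw [e] at h1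
  set Z := ∑ t, y t * φ q t - L / M * ∑ i, rsign (a i).2 * φ q (a i).1
  have hℓ2 : ℓ = M * s ^ 2 := by rw [hs2]; field_simp
  have h2 : M * (2 * (s / L) ^ 2 * L ^ 2) = 2 * (M * s ^ 2) := by field_simp
  rw [h2, hℓ2] at h1
  have h3 : (M * s / L) * Z ≤ (M * s / L) * (3 * L * s) := by
    calc _ = s / L * (M * Z) := by ring
      _ ≤ _ := h1
      _ = _ := by field_simp; ring
  exact le_of_mul_le_mul_left h3 (by positivity)

end Maurey

section CirculantChain

variable {G β ι : Type*} [AddCommGroup G] [Fintype G] [DecidableEq G] [Fintype β]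

lemma exists_spectral_approx (y : G → ℝ) {L : ℝ} (hL : 0 < L) (hy : ∑ t, |y t| ≤ L) {M : ℕ}
    (hM : 0 < M) : ∃ a : Fin M → G × Bool, ∀ ψ : AddChar G ℂ,
      ‖ft y ψ - (L / M : ℝ) * ∑ i, (rsign (a i).2 : ℂ) * ψ (a i).1‖ ≤
        6 * L * Real.sqrt (Real.log (4 * Fintype.card G) / M) := by
  set φ : AddChar G ℂ × Bool × Bool → G → ℝ :=
    fun q t => rsign q.2.2 * (if q.2.1 then (q.1 t).re else (q.1 t).im) with hφ
  have hcard : Fintype.card (AddChar G ℂ × Bool × Bool) = 4 * Fintype.card G := by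
    simp only [Fintype.card_prod, Fintype.card_bool]
    have h : Fintype.card (AddChar G ℂ) = Fintype.card G := by convert AddChar.card_eq
    rw [h]
    ring
  have hn : 0 < Fintype.card G := Fintype.card_pos
  have hb : ∀ q t, |φ q t| ≤ 1 := by
    rintro ⟨ψ, c, s⟩ t
    have h1 : |(ψ t).re| ≤ 1 := (Complex.abs_re_le_norm _).trans (by simp)
    have h2 : |(ψ t).im| ≤ 1 := (Complex.abs_im_le_norm _).trans (by simp)
    cases c <;> cases s <;> simp [hφ, rsign, h1, h2]
  obtain ⟨a, ha⟩ := exists_approx φ hb y hL hy hM (by rw [hcard]; omega)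
  rw [hcard] at ha
  push_cast at ha
  refine ⟨a, fun ψ => ?_⟩
  set Z := ft y ψ - (L / M : ℝ) * ∑ i, (rsign (a i).2 : ℂ) * ψ (a i).1 with hZ
  have hre : Z.re = ∑ t, y t * (ψ t).re - L / M * ∑ i, rsign (a i).2 * (ψ (a i).1).re := by
    simp [hZ, ft, Complex.re_sum, Complex.im_sum]
  have him : Z.im = ∑ t, y t * (ψ t).im - L / M * ∑ i, rsign (a i).2 * (ψ (a i).1).im := by
    simp [hZ, ft, Complex.re_sum, Complex.im_sum]
  have hr : ∀ b, rsign b * Z.re ≤ 3 * L * Real.sqrt (Real.log (4 * Fintype.card G) / M) := by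
    intro b
    refine le_trans (le_of_eq ?_) (ha (ψ, true, b))
    rw [hre, mul_sub, Finset.mul_sum, mul_left_comm, Finset.mul_sum]
    simp only [hφ, if_true, mul_left_comm]
  have hi : ∀ b, rsign b * Z.im ≤ 3 * L * Real.sqrt (Real.log (4 * Fintype.card G) / M) := by
    intro b
    refine le_trans (le_of_eq ?_) (ha (ψ, false, b))
    rw [him, mul_sub, Finset.mul_sum, mul_left_comm, Finset.mul_sum]
    simp only [hφ, Bool.false_eq_true, if_false, mul_left_comm]
  have h1 := hr true
  have h2 := hr false
  have h3 := hi true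
  have h4 := hi false
  simp only [rsign, if_true, Bool.false_eq_true, if_false] at h1 h2 h3 h4
  have h5 : |Z.re| ≤ 3 * L * Real.sqrt (Real.log (4 * Fintype.card G) / M) :=
    abs_le.mpr ⟨by linarith, by linarith⟩
  have h6 : |Z.im| ≤ 3 * L * Real.sqrt (Real.log (4 * Fintype.card G) / M) :=
    abs_le.mpr ⟨by linarith, by linarith⟩
  have := Complex.norm_le_abs_re_add_abs_im Z
  linarith

/-- The matrix `σ ↦ c B (σ ∗ y)` as a function of `σ`. -/
def gam (c : ℝ) (B : β → G → ℝ) (y : G → ℝ) : β → G → ℝ := fun i s => c * ∑ j, B i j * y (j - s)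

lemma gam_sub (c : ℝ) (B : β → G → ℝ) (y z : G → ℝ) :
    gam c B y - gam c B z = gam c B (y - z) := by
  funext i s
  simp [gam, mul_sub, Finset.sum_sub_distrib]

lemma ap_gam (c : ℝ) (B : β → G → ℝ) (y a : G → ℝ) :
    ap (gam c B y) a = c • ap B (ap (fun j s => y (j - s)) a) := by
  funext i
  simp only [ap, gam, Pi.smul_apply, smul_eq_mul, Finset.mul_sum, Finset.sum_mul]
  rw [Finset.sum_comm]
  exact Finset.sum_congr rfl fun _ _ => Finset.sum_congr rfl fun _ _ => by ring

lemma opLe_gam {c : ℝ} (hc : 0 ≤ c) {B : β → G → ℝ} (hB : OpLe B 1) {y : G → ℝ} {U : ℝ}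
    (hU : 0 ≤ U) (h : ∀ ψ : AddChar G ℂ, ‖ft y ψ‖ ≤ U) : OpLe (gam c B y) (c * U) := by
  refine opLe_of_nm_le fun a => ?_
  rw [ap_gam, nm_smul, abs_of_nonneg hc, mul_assoc]
  refine mul_le_mul_of_nonneg_left ?_ hc
  refine (hB.nm_le zero_le_one _).trans ?_
  rw [one_mul]
  exact (opLe_circulant y U h).nm_le hU a

variable [Fintype ι] [DecidableEq ι]

/-- Entropy numbers of an `ℓ¹` ball by empirical approximation. -/
lemma exists_chain {c : ℝ} (hc : 0 ≤ c) {B : β → G → ℝ} (hB : OpLe B 1) (Y : ι → G → ℝ) {L : ℝ}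
    (hL : 0 < L) (hY : ∀ i, ∑ t, |Y i t| ≤ L) (i₀ : ι) (hi₀ : Y i₀ = 0) (J : ℕ) :
    ∃ π, Chain (fun i => gam c B (Y i)) J π (fun l => (4 * (Fintype.card G : ℝ)) ^ 4 ^ l)
      (fun l => 12 * (c * L) * Real.sqrt (Real.log (4 * Fintype.card G)) / 2 ^ l) i₀ := by
  have hn : (1 : ℝ) ≤ Fintype.card G := by exact_mod_cast Fintype.card_pos
  have hlog : 1 ≤ Real.log (4 * Fintype.card G) := by
    rw [Real.le_log_iff_exp_le (by linarith)]
    have := Real.exp_one_lt_d9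
    linarith
  set q := Real.sqrt (Real.log (4 * Fintype.card G)) with hq
  have hq1 : 1 ≤ q := Real.one_le_sqrt.mpr hlog
  choose a ha using fun (l : ℕ) (i : ι) =>
    exists_spectral_approx (Y i) hL (hY i) (M := 4 ^ l) (by positivity)
  have hsq : ∀ l : ℕ, Real.sqrt (Real.log (4 * Fintype.card G) / (4 ^ l : ℕ)) = q / 2 ^ l := by
    intro l
    rw [Real.sqrt_div (by linarith)]
    congr 1
    rw [show ((4 ^ l : ℕ) : ℝ) = (2 ^ l) ^ 2 by push_cast; rw [← pow_mul, mul_comm, pow_mul]; norm_num]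
    exact Real.sqrt_sq (by positivity)
  classical
  let rep : (l : ℕ) → (Fin (4 ^ l) → G × Bool) → ι := fun l f =>
    if h : ∃ i, a l i = f then h.choose else i₀
  have hrep : ∀ l i, a l (rep l (a l i)) = a l i := by
    intro l i
    have h : ∃ j, a l j = a l i := ⟨i, rfl⟩
    simp only [rep, dif_pos h]
    exact h.choose_spec
  refine ⟨fun l i => if l = 0 then i₀ else rep l (a l i), ?_, ?_, ?_, ?_, ?_, ?_⟩
  · intro l
    exact one_le_pow₀ (by linarith)
  · intro l; positivity
  · intro l
    rcases Nat.eq_zero_or_pos l with rfl | hl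
    · simp only [if_true]
      have h1 : (Finset.univ.image fun _ : ι => i₀) ⊆ {i₀} := by
        intro x hx
        obtain ⟨_, _, rfl⟩ := Finset.mem_image.mp hx
        simp
      have h2 := Finset.card_le_card h1
      rw [Finset.card_singleton] at h2
      calc _ ≤ ((1 : ℕ) : ℝ) := Nat.cast_le.mpr h2
        _ ≤ _ := by norm_num; linarith
    · have h1 : (Finset.univ.image fun i => if l = 0 then i₀ else rep l (a l i)) ⊆
          Finset.univ.image (rep l) := by
        intro x hx
        obtain ⟨i, _, rfl⟩ := Finset.mem_image.mp hx
        rw [if_neg hl.ne']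
        exact Finset.mem_image_of_mem _ (Finset.mem_univ _)
      have h2 := (Finset.card_le_card h1).trans Finset.card_image_le
      rw [Finset.card_univ, Fintype.card_fun, Fintype.card_prod, Fintype.card_bool,
        Fintype.card_fin] at h2
      refine (Nat.cast_le.mpr h2).trans ?_
      push_cast
      exact pow_le_pow_left₀ (by positivity) (by linarith) _
  · intro l i
    simp only [gam_sub]
    rcases Nat.eq_zero_or_pos l with rfl | hl
    · simp only [if_true, hi₀, sub_zero, pow_zero, div_one]
      have h1 := opLe_gam hc hB hL.le (fun ψ => (norm_ft_le (Y i) ψ).trans (hY i))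
      intro z
      refine (h1 z).trans (mul_le_mul_of_nonneg_right ?_ (by positivity))
      refine pow_le_pow_left₀ (by positivity) ?_ 2
      have : 0 ≤ c * L := by positivity
      nlinarith
    · rw [if_neg hl.ne']
      have e : 12 * (c * L) * q / 2 ^ l = c * (12 * L * (q / 2 ^ l)) := by ring
      rw [e]
      refine opLe_gam hc hB (by positivity) fun ψ => ?_
      have h1 := ha l i ψ
      have h2 := ha l (rep l (a l i)) ψ
      rw [hrep, norm_sub_rev] at h2
      rw [hsq] at h1 h2
      rw [ft_sub]
      calc _ ≤ _ := norm_sub_le_norm_sub_add_norm_sub _ _ _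
        _ ≤ _ := add_le_add h1 h2
        _ = _ := by ring
  · intro i; simp
  · funext i s; simp [gam, hi₀]

end CirculantChain

lemma chainSum_le {n : ℕ} (hn : 2 ≤ n) {A : ℝ} (hA : 0 ≤ A) :
    chainSum n (Nat.log 2 n + 1) (fun l => (4 * (n : ℝ)) ^ 4 ^ l)
      (fun l => 12 * A * Real.sqrt (Real.log (4 * n)) / 2 ^ l) ≤ 1512 * A * Real.log n ^ 2 := by
  have hn' : (2 : ℝ) ≤ n := by exact_mod_cast hn
  set q := Real.sqrt (Real.log (4 * n)) with hq
  have hl2 : 0.69 < Real.log 2 := by have := Real.log_two_gt_d9; linarith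
  have hln : Real.log 2 ≤ Real.log n := Real.log_le_log (by norm_num) hn'
  have hl4 : Real.log (4 * n) ≤ 3 * Real.log n := by
    rw [Real.log_mul (by norm_num) (by linarith), show (4 : ℝ) = 2 ^ 2 by norm_num, Real.log_pow]
    push_cast; linarith
  have hl1 : 1 ≤ Real.log (4 * n) := by
    rw [Real.le_log_iff_exp_le (by linarith)]
    have := Real.exp_one_lt_d9
    linarith
  have hq2 : q ^ 2 = Real.log (4 * n) := Real.sq_sqrt (by linarith)
  have hq1 : 1 ≤ q := Real.one_le_sqrt.mpr hl1
  set J := Nat.log 2 n + 1 with hJ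
  have hJn : (n : ℝ) ≤ 2 ^ J := by exact_mod_cast (Nat.lt_pow_succ_log_self one_lt_two n).le
  have hJl : (J : ℝ) ≤ 3 * Real.log n := by
    have h1 : (2 : ℝ) ^ Nat.log 2 n ≤ n := by exact_mod_cast Nat.pow_log_le_self 2 (by omega)
    have h2 := Real.log_le_log (by positivity) h1
    rw [Real.log_pow] at h2
    rw [hJ]; push_cast
    nlinarith [Nat.cast_nonneg (α := ℝ) (Nat.log 2 n)]
  have hJ1 : (1 : ℝ) ≤ J := by rw [hJ]; push_cast; linarith [Nat.cast_nonneg (α := ℝ) (Nat.log 2 n)]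
  have hterm : ∀ l : ℕ, (12 * A * q / 2 ^ l + 12 * A * q / 2 ^ (l + 1)) *
      Real.sqrt (2 * Real.log (2 * ((4 * (n : ℝ)) ^ 4 ^ l * (4 * (n : ℝ)) ^ 4 ^ (l + 1)))) ≤
      72 * A * q ^ 2 := by
    intro l
    have h4 : (1 : ℝ) ≤ 4 ^ l := one_le_pow₀ (by norm_num)
    have h1 : Real.sqrt (2 * Real.log (2 * ((4 * (n : ℝ)) ^ 4 ^ l * (4 * (n : ℝ)) ^ 4 ^ (l + 1)))) ≤
        4 * 2 ^ l * q := by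
      rw [Real.sqrt_le_left (by positivity)]
      rw [Real.log_mul (by norm_num) (by positivity), Real.log_mul (by positivity) (by positivity),
        Real.log_pow, Real.log_pow]
      have h3 : Real.log 2 ≤ Real.log (4 * n) := Real.log_le_log (by norm_num) (by linarith)
      have h5 : (4 * 2 ^ l * q) ^ 2 = 16 * 4 ^ l * Real.log (4 * n) := by
        rw [mul_pow, mul_pow, hq2, ← pow_mul, mul_comm l 2, pow_mul]; norm_num
      rw [h5]
      push_cast
      rw [pow_succ]
      nlinarith
    have h0 : 0 ≤ 12 * A * q / 2 ^ l + 12 * A * q / 2 ^ (l + 1) := by positivity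
    refine (mul_le_mul_of_nonneg_left h1 h0).trans (le_of_eq ?_)
    field_simp
    ring
  have hsum := Finset.sum_le_sum fun l (_ : l ∈ Finset.range J) => hterm l
  rw [Finset.sum_const, Finset.card_range, nsmul_eq_mul] at hsum
  have hlast : 2 * (12 * A * q / 2 ^ J) * Real.sqrt n ≤ 24 * A * q ^ 2 := by
    have h1 : Real.sqrt n ≤ n := by
      rw [Real.sqrt_le_left (by linarith)]; nlinarith
    have h2 : Real.sqrt n / 2 ^ J ≤ 1 := by
      rw [div_le_one (by positivity)]; exact h1.trans hJn
    calc _ = 24 * A * q * (Real.sqrt n / 2 ^ J) := by ring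
      _ ≤ 24 * A * q * 1 := mul_le_mul_of_nonneg_left h2 (by positivity)
      _ ≤ 24 * A * q * q := mul_le_mul_of_nonneg_left hq1 (by positivity)
      _ = _ := by ring
  rw [chainSum]
  have h1 : J * q ^ 2 ≤ 9 * Real.log n ^ 2 := by
    rw [hq2]
    calc _ ≤ (3 * Real.log n) * (3 * Real.log n) := mul_le_mul hJl hl4 (by linarith) (by linarith)
      _ = _ := by ring
  have h2 : A * (J * q ^ 2) ≤ A * (9 * Real.log n ^ 2) := mul_le_mul_of_nonneg_left h1 hA
  have h3 : A * q ^ 2 ≤ A * (J * q ^ 2) := by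
    refine mul_le_mul_of_nonneg_left ?_ hA
    nlinarith [sq_nonneg q]
  calc _ ≤ 2 * (J * (72 * A * q ^ 2)) + 24 * A * q ^ 2 :=
        add_le_add (mul_le_mul_of_nonneg_left hsum (by norm_num)) hlast
    _ ≤ _ := by linarith

section RestrictedIsometry

variable {μ τ β G : Type*} [Fintype μ] [DecidableEq μ] [Fintype τ] [Fintype β] [DecidableEq β]

lemma expect_exp_sq_sub_le {A : τ → μ → ℝ} (hA : OpLe A 1) {θ : ℝ} (hθ : |θ| ≤ 1 / 12) :
    𝔼 ε : μ → Bool, Real.exp (θ * (∑ t, ap A (sg ε) t ^ 2 - ∑ t, ∑ j, A t j ^ 2)) ≤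
      Real.exp (16 * θ ^ 2 * ∑ t, ∑ j, A t j ^ 2) := by
  set W : μ → μ → ℝ := fun j j' => ∑ t, A t j * A t j' with hW
  have hWop : OpLe W 1 := by
    have := hA.transpose.comp hA
    rwa [one_mul] at this
  have hθW : OpLe (fun j j' => θ * W j j') |θ| := by
    intro a
    have := mul_le_mul_of_nonneg_left (hWop a) (sq_nonneg θ)
    simp only [mul_assoc, ← Finset.mul_sum, mul_pow, sq_abs]
    simpa only [← Finset.mul_sum, one_pow, one_mul] using this
  have h := expect_exp_chaos_le _ |θ| (abs_nonneg θ) hθ hθW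
  have hF : ∑ j, ∑ j', (θ * W j j') ^ 2 ≤ θ ^ 2 * ∑ t, ∑ j, A t j ^ 2 := by
    simp only [mul_pow, ← Finset.mul_sum]
    refine mul_le_mul_of_nonneg_left ?_ (sq_nonneg θ)
    rw [Finset.sum_comm, Finset.sum_comm (f := fun t j => A t j ^ 2)]
    refine Finset.sum_le_sum fun j' _ => ?_
    have := hA.transpose (fun t => A t j')
    simpa [hW] using this
  calc _ = 𝔼 ε : μ → Bool, Real.exp (∑ j, ∑ j',
        (if j = j' then 0 else θ * W j j' * sg ε j * sg ε j')) := by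
        refine Finset.expect_congr rfl fun ε _ => ?_
        have e1 := sum_sq_mulVec_eq A (sg ε)
        simp only [sg_sq, mul_one] at e1
        rw [Finset.sum_comm (f := fun s t => A t s ^ 2)] at e1
        simp only [ap]
        rw [e1, add_sub_cancel_left]
        simp only [Finset.mul_sum, mul_ite, mul_zero, hW]
        congr 1
        refine Finset.sum_congr rfl fun j _ => Finset.sum_congr rfl fun j' _ => ?_
        split_ifs
        · rfl
        · rw [← Finset.mul_sum]; ring
    _ ≤ _ := h
    _ ≤ _ := by
        refine Real.exp_le_exp.mpr ?_
        linarith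

/-- The random matrix with disjointly supported rows: entry `w j ε j` at `(b j, e j)`. -/
def blk [DecidableEq G] (b : μ → β) (e : μ → G) (w : μ → ℝ) (ε : μ → Bool) : β → G → ℝ :=
  fun i s => ∑ j, if b j = i then (if e j = s then w j * sg ε j else 0) else 0

lemma sum_blk_mul [DecidableEq G] [Fintype G] (b : μ → β) (e : μ → G) (w : μ → ℝ) (ε : μ → Bool)
    (a : G → ℝ) (i : β) :
    ∑ s, blk b e w ε i s * a s = ∑ j, if b j = i then w j * sg ε j * a (e j) else 0 := by
  simp only [blk, Finset.sum_mul]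
  rw [Finset.sum_comm]
  refine Finset.sum_congr rfl fun j _ => ?_
  split_ifs with h
  · simp
  · simp

lemma opLe_blk [DecidableEq G] [Fintype G] {b : μ → β} {e : μ → G} (he : Function.Injective e)
    {w : μ → ℝ} (hw : ∀ i, ∑ j, (if b j = i then w j ^ 2 else 0) = 1) (ε : μ → Bool) :
    OpLe (blk b e w ε) 1 := by
  intro a
  simp only [sum_blk_mul, one_pow, one_mul]
  have h1 : ∀ i, (∑ j, if b j = i then w j * sg ε j * a (e j) else 0) ^ 2 ≤
      ∑ j, if b j = i then a (e j) ^ 2 else 0 := by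
    intro i
    have := Finset.sum_mul_sq_le_sq_mul_sq Finset.univ (fun j => if b j = i then w j * sg ε j else 0)
      (fun j => if b j = i then a (e j) else 0)
    simp only [ite_pow, mul_pow, sg_sq, mul_one, hw i, one_mul, zero_pow two_ne_zero,
      ite_mul, zero_mul] at this
    refine le_trans (le_of_eq ?_) this
    congr 1
    refine Finset.sum_congr rfl fun j _ => ?_
    split_ifs <;> rfl
  refine (Finset.sum_le_sum fun i _ => h1 i).trans ?_
  rw [Finset.sum_comm]
  simp only [Finset.sum_ite_eq, Finset.mem_univ, if_true]
  rw [← Finset.sum_image (f := fun s => a s ^ 2) (fun x _ y _ h => he h)]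
  exact Finset.sum_le_sum_of_subset_of_nonneg (Finset.subset_univ _) fun _ _ _ => sq_nonneg _

variable [AddCommGroup G] [Fintype G] [DecidableEq G]

/-- Real and imaginary parts of the Fourier coefficients of the rows of `blk`, as linear forms
in the signs. -/
def blkFt (b : μ → β) (e : μ → G) (w : μ → ℝ) (ψ : AddChar G ℂ) : β × Bool → μ → ℝ :=
  fun i j => if b j = i.1 then w j * (if i.2 then (ψ (e j)).re else (ψ (e j)).im) else 0

lemma re_sq_add_im_sq (ψ : AddChar G ℂ) (t : G) : (ψ t).re ^ 2 + (ψ t).im ^ 2 = 1 := by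
  have h := Complex.sq_norm (ψ t)
  rw [Complex.normSq_apply] at h
  have : ‖ψ t‖ = 1 := by simp
  rw [this] at h
  linarith

lemma sum_norm_ft_blk (b : μ → β) (e : μ → G) (w : μ → ℝ) (ψ : AddChar G ℂ) (ε : μ → Bool) :
    ∑ i, ‖ft (blk b e w ε i) ψ‖ ^ 2 = ∑ i, ap (blkFt b e w ψ) (sg ε) i ^ 2 := by
  rw [Fintype.sum_prod_type]
  refine Finset.sum_congr rfl fun i _ => ?_
  rw [Fintype.sum_bool, Complex.sq_norm, Complex.normSq_apply, ← sq, ← sq]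
  congr 2
  · have := sum_blk_mul b e w ε (fun t => (ψ t).re) i
    simp only [ft, Complex.re_sum, Complex.re_ofReal_mul, this, ap, blkFt, if_true]
    refine Finset.sum_congr rfl fun j _ => ?_
    split_ifs <;> ring
  · have := sum_blk_mul b e w ε (fun t => (ψ t).im) i
    simp only [ft, Complex.im_sum, Complex.im_ofReal_mul, this, ap, blkFt, Bool.false_eq_true,
      if_false]
    refine Finset.sum_congr rfl fun j _ => ?_
    split_ifs <;> ring

lemma sum_blkFt_sq {b : μ → β} {w : μ → ℝ} (e : μ → G)
    (hw : ∀ i, ∑ j, (if b j = i then w j ^ 2 else 0) = 1) (ψ : AddChar G ℂ) :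
    ∑ i, ∑ j, blkFt b e w ψ i j ^ 2 = Fintype.card β := by
  rw [Fintype.sum_prod_type, ← Finset.card_univ, Finset.card_eq_sum_ones, Nat.cast_sum]
  refine Finset.sum_congr rfl fun i _ => ?_
  rw [Fintype.sum_bool, ← Finset.sum_add_distrib, Nat.cast_one, ← hw i]
  refine Finset.sum_congr rfl fun j _ => ?_
  by_cases h : b j = i
  · have := re_sq_add_im_sq ψ (e j)
    simp only [blkFt, h, if_true, Bool.false_eq_true, if_false]
    linear_combination w j ^ 2 * this
  · simp [blkFt, h]

lemma opLe_blkFt {b : μ → β} {w : μ → ℝ} (e : μ → G)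
    (hw : ∀ i, ∑ j, (if b j = i then w j ^ 2 else 0) = 1) (ψ : AddChar G ℂ) :
    OpLe (blkFt b e w ψ) 1 := by
  intro a
  rw [Fintype.sum_prod_type, one_pow, one_mul]
  have h1 : ∀ i, ∑ c, (∑ j, blkFt b e w ψ (i, c) j * a j) ^ 2 ≤
      ∑ j, if b j = i then a j ^ 2 else 0 := by
    intro i
    set Z : ℂ := ∑ j, if b j = i then (w j * a j : ℝ) * ψ (e j) else 0 with hZ
    have e1 : ∑ j, blkFt b e w ψ (i, true) j * a j = Z.re := by
      rw [hZ, Complex.re_sum]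
      refine Finset.sum_congr rfl fun j _ => ?_
      by_cases h : b j = i
      · simp only [blkFt, h, if_true, Complex.re_ofReal_mul]; ring
      · simp [blkFt, h]
    have e2 : ∑ j, blkFt b e w ψ (i, false) j * a j = Z.im := by
      rw [hZ, Complex.im_sum]
      refine Finset.sum_congr rfl fun j _ => ?_
      by_cases h : b j = i
      · simp only [blkFt, h, if_true, Complex.im_ofReal_mul, Bool.false_eq_true, if_false]; ring
      · simp [blkFt, h]
    rw [Fintype.sum_bool, e1, e2, sq, sq, ← Complex.normSq_apply, ← Complex.sq_norm]
    have h2 : ‖Z‖ ≤ ∑ j, (if b j = i then |w j| else 0) * (if b j = i then |a j| else 0) := by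
      refine (norm_sum_le _ _).trans (Finset.sum_le_sum fun j _ => ?_)
      split_ifs
      · simp
      · simp
    refine (pow_le_pow_left₀ (norm_nonneg _) h2 2).trans ?_
    refine (Finset.sum_mul_sq_le_sq_mul_sq _ _ _).trans (le_of_eq ?_)
    simp only [ite_pow, sq_abs, zero_pow two_ne_zero, hw i, one_mul]
  refine (Finset.sum_le_sum fun i _ => h1 i).trans (le_of_eq ?_)
  rw [Finset.sum_comm]
  simp

/-- Largest deviation of the averaged spectral mass of the rows from one. -/
def specDev (B : β → G → ℝ) : ℝ :=
  ⨆ ψ : AddChar G ℂ, |(∑ i, ‖ft (B i) ψ‖ ^ 2) / Fintype.card β - 1|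

lemma le_specDev (B : β → G → ℝ) (ψ : AddChar G ℂ) :
    |(∑ i, ‖ft (B i) ψ‖ ^ 2) / Fintype.card β - 1| ≤ specDev B :=
  le_ciSup (f := fun ψ : AddChar G ℂ => |(∑ i, ‖ft (B i) ψ‖ ^ 2) / Fintype.card β - 1|)
    (Set.finite_range _).bddAbove ψ

lemma specDev_nonneg (B : β → G → ℝ) : 0 ≤ specDev B := Real.iSup_nonneg fun _ => abs_nonneg _

lemma expect_specDev_le [Nonempty β] {b : μ → β} {w : μ → ℝ} (e : μ → G)
    (hw : ∀ i, ∑ j, (if b j = i then w j ^ 2 else 0) = 1)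
    (hp : Real.log (2 * Fintype.card G) ≤ Fintype.card β) :
    𝔼 ε : μ → Bool, specDev (blk b e w ε) ≤
      14 * Real.sqrt (Real.log (2 * Fintype.card G) / Fintype.card β) := by
  have hn : (1 : ℝ) ≤ Fintype.card G := by exact_mod_cast Fintype.card_pos
  have hp0 : (0 : ℝ) < Fintype.card β := by exact_mod_cast Fintype.card_pos
  have hl : 0 < Real.log (2 * Fintype.card G) := Real.log_pos (by linarith)
  set p : ℝ := ((Fintype.card β : ℕ) : ℝ) with hpdef
  set ℓ := Real.log (2 * Fintype.card G) with hℓ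
  set s := Real.sqrt (ℓ / p) with hs
  have hs0 : 0 < s := Real.sqrt_pos.mpr (div_pos hl hp0)
  have hs2 : s ^ 2 = ℓ / p := Real.sq_sqrt (div_pos hl hp0).le
  have hs1 : s ≤ 1 := Real.sqrt_le_one.mpr ((div_le_one hp0).mpr hp)
  have hℓs : ℓ = p * s ^ 2 := by rw [hs2]; field_simp
  set X : AddChar G ℂ → (μ → Bool) → ℝ := fun ψ ε =>
    ∑ i, ap (blkFt b e w ψ) (sg ε) i ^ 2 - ∑ i, ∑ j, blkFt b e w ψ i j ^ 2 with hX
  have hXd : ∀ ψ ε, |(∑ i, ‖ft (blk b e w ε i) ψ‖ ^ 2) / p - 1| = |X ψ ε| / p := by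
    intro ψ ε
    rw [hX]
    simp only
    rw [sum_blkFt_sq e hw, ← sum_norm_ft_blk, ← hpdef, ← abs_of_pos hp0, ← abs_div, abs_of_pos hp0]
    congr 1
    field_simp
  have hexp : ∀ ψ (θ : ℝ), |θ| = s / 12 →
      𝔼 ε, Real.exp (θ * X ψ ε) ≤ Real.exp (p * s ^ 2 / 9) := by
    intro ψ θ hθ
    refine (expect_exp_sq_sub_le (opLe_blkFt e hw ψ) (by rw [hθ]; linarith)).trans ?_
    rw [sum_blkFt_sq e hw, ← hpdef, ← sq_abs θ, hθ]
    exact Real.exp_le_exp.mpr (le_of_eq (by ring))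
  have hpt : ∀ ε, Real.exp (s / 12 * p * specDev (blk b e w ε)) ≤
      ∑ ψ, (Real.exp (s / 12 * X ψ ε) + Real.exp (-(s / 12) * X ψ ε)) := by
    intro ε
    obtain ⟨ψ, hψ⟩ := Set.Nonempty.csSup_mem (Set.range_nonempty
      fun ψ : AddChar G ℂ => |(∑ i, ‖ft (blk b e w ε i) ψ‖ ^ 2) / Fintype.card β - 1|)
      (Set.finite_range _)
    have e1 : specDev (blk b e w ε) = |X ψ ε| / p := by rw [← hXd]; exact hψ.symm
    have e2 : s / 12 * p * (|X ψ ε| / p) = |s / 12 * X ψ ε| := by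
      rw [abs_mul, abs_of_pos (show 0 < s / 12 by positivity)]; field_simp
    rw [e1, e2]
    refine le_trans ?_ (Finset.single_le_sum (f := fun ψ => Real.exp (s / 12 * X ψ ε) +
      Real.exp (-(s / 12) * X ψ ε)) (fun ψ _ => by positivity) (Finset.mem_univ ψ))
    rw [neg_mul]
    rcases abs_choice (s / 12 * X ψ ε) with h | h <;> rw [h]
    · exact le_add_of_nonneg_right (Real.exp_pos _).le
    · exact le_add_of_nonneg_left (Real.exp_pos _).le
  have hcard : Fintype.card (AddChar G ℂ) = Fintype.card G := by convert AddChar.card_eq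
  have h1 : Real.exp (s / 12 * p * 𝔼 ε, specDev (blk b e w ε)) ≤ Real.exp (ℓ + p * s ^ 2 / 9) := by
    rw [Finset.mul_expect]
    refine (exp_expect_le _).trans ((Finset.expect_le_expect fun ε _ => hpt ε).trans ?_)
    rw [Finset.expect_sum_comm]
    calc _ ≤ ∑ ψ : AddChar G ℂ, 2 * Real.exp (p * s ^ 2 / 9) := by
          refine Finset.sum_le_sum fun ψ _ => ?_
          rw [Finset.expect_add_distrib, two_mul]
          exact add_le_add (hexp ψ _ (abs_of_pos (by positivity)))
            (hexp ψ _ (by rw [abs_neg, abs_of_pos (by positivity)]))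
      _ = _ := by
          rw [Finset.sum_const, Finset.card_univ, hcard, Real.exp_add, hℓ,
            Real.exp_log (by linarith), nsmul_eq_mul]
          ring
  rw [Real.exp_le_exp, hℓs] at h1
  have h2 : s / 12 * p * 𝔼 ε, specDev (blk b e w ε) ≤ s / 12 * p * (14 * s) := by
    refine h1.trans ?_
    have : 0 ≤ p * s ^ 2 := by positivity
    nlinarith
  exact le_of_mul_le_mul_left h2 (by positivity)

end RestrictedIsometry

section RipExpectation

variable {μ β G : Type*} [Fintype μ] [DecidableEq μ] [Fintype β] [DecidableEq β] [AddCommGroup G]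
  [Fintype G] [DecidableEq G]

lemma abs_frob_gam_sub_le [Nonempty β] (B : β → G → ℝ) (y : G → ℝ) :
    |∑ i, ∑ s, gam (1 / Real.sqrt (Fintype.card β)) B y i s ^ 2 - ∑ t, y t ^ 2| ≤
      specDev B * ∑ t, y t ^ 2 := by
  have hn : (0 : ℝ) < Fintype.card G := by exact_mod_cast Fintype.card_pos
  have hp : (0 : ℝ) < Fintype.card β := by exact_mod_cast Fintype.card_pos
  have hc : (1 / Real.sqrt (Fintype.card β)) ^ 2 = 1 / (Fintype.card β : ℝ) := by
    rw [div_pow, one_pow, Real.sq_sqrt hp.le]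
  have h1 : Fintype.card G * ∑ i, ∑ s, gam (1 / Real.sqrt (Fintype.card β)) B y i s ^ 2 =
      ∑ ψ : AddChar G ℂ, ‖ft y ψ‖ ^ 2 * ((∑ i, ‖ft (B i) ψ‖ ^ 2) / Fintype.card β) := by
    simp only [gam, mul_pow, hc, ← Finset.mul_sum]
    rw [mul_left_comm, Finset.mul_sum]
    simp only [card_mul_sum_correlation_sq]
    rw [Finset.sum_comm, Finset.mul_sum]
    refine Finset.sum_congr rfl fun ψ _ => ?_
    rw [← Finset.mul_sum]
    ring
  refine le_of_mul_le_mul_left ?_ hn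
  rw [← abs_of_pos hn, ← abs_mul, abs_of_pos hn, mul_sub, h1, ← sum_norm_ft_sq,
    ← Finset.sum_sub_distrib, mul_left_comm, ← sum_norm_ft_sq, Finset.mul_sum]
  refine (Finset.abs_sum_le_sum_abs _ _).trans (Finset.sum_le_sum fun ψ _ => ?_)
  rw [← mul_sub_one, abs_mul, abs_of_nonneg (sq_nonneg ‖ft y ψ‖), mul_comm]
  exact mul_le_mul_of_nonneg_right (le_specDev B ψ) (sq_nonneg _)

lemma expect_rip_le [Nonempty β] {B : β → G → ℝ} (hB : OpLe B 1) (hn : 2 ≤ Fintype.card G)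
    {L S : ℝ} (hL : 0 < L)
    (hS : S = 1512 * (1 / Real.sqrt (Fintype.card β) * L) * Real.log (Fintype.card G) ^ 2)
    (hS1 : 4 * S ≤ 1) (sel : (G → Bool) → G → ℝ) (h1 : ∀ σ, ∑ t, |sel σ t| ≤ L)
    (h2 : ∀ σ, ∑ t, sel σ t ^ 2 ≤ 1) :
    𝔼 σ : G → Bool, |∑ i, ap (gam (1 / Real.sqrt (Fintype.card β)) B (sel σ)) (sg σ) i ^ 2 -
        ∑ t, sel σ t ^ 2| ≤ 8 * S + 2 * specDev B := by
  set c := 1 / Real.sqrt (Fintype.card β) with hc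
  have hc0 : 0 ≤ c := by positivity
  set Θ := specDev B with hΘ
  have hΘ0 : 0 ≤ Θ := specDev_nonneg B
  let Y : Option (G → Bool) → G → ℝ := fun o => o.elim 0 sel
  have hY1 : ∀ o, ∑ t, |Y o t| ≤ L := by
    rintro (_ | σ)
    · simpa [Y] using hL.le
    · exact h1 σ
  have hY2 : ∀ o, ∑ t, Y o t ^ 2 ≤ 1 := by
    rintro (_ | σ)
    · simp [Y]
    · exact h2 σ
  obtain ⟨π, hπ⟩ := exists_chain hc0 hB Y hL hY1 none rfl (Nat.log 2 (Fintype.card G) + 1)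
  have hcs := chainSum_le hn (A := c * L) (by positivity)
  set Γ : Option (G → Bool) → β → G → ℝ := fun o => gam c B (Y o) with hΓ
  set D := chainSum (Fintype.card G) (Nat.log 2 (Fintype.card G) + 1)
    (fun l => (4 * (Fintype.card G : ℝ)) ^ 4 ^ l)
    (fun l => 12 * (c * L) * Real.sqrt (Real.log (4 * Fintype.card G)) / 2 ^ l) with hD
  have hDS : D ≤ S := by rw [hS]; exact hcs
  have hS0 : 0 ≤ S := by rw [hS]; positivity
  let X : Option (G → Bool) → (G → Bool) → ℝ := fun o σ =>
    |∑ t, ap (Γ o) (sg σ) t ^ 2 - ∑ t, ∑ s, Γ o t s ^ 2|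
  choose m hm using fun σ : G → Bool => Finite.exists_max fun o => X o σ
  have hX := hπ.expect_chaos_le m
  have hF : ∀ o, |∑ t, ∑ s, Γ o t s ^ 2 - ∑ t, Y o t ^ 2| ≤ Θ := by
    intro o
    refine (abs_frob_gam_sub_le B (Y o)).trans ?_
    exact mul_le_of_le_one_right hΘ0 (hY2 o)
  have hR : ∀ σ : G → Bool, supNm Γ (sg σ) ≤ 1 + Θ / 2 + X (m σ) σ / 2 := by
    intro σ
    refine ciSup_le fun o => ?_
    have e1 := nm_sq (ap (Γ o) (sg σ))
    have e2 := (abs_le.mp ((le_refl (X o σ)).trans (hm σ o))).2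
    have e3 := (abs_le.mp (hF o)).2
    have e4 := hY2 o
    nlinarith [sq_nonneg (nm (ap (Γ o) (sg σ)) - 1)]
  have hER : 𝔼 σ : G → Bool, supNm Γ (sg σ) ≤ 1 + Θ / 2 + (𝔼 σ : G → Bool, X (m σ) σ) / 2 := by
    refine (Finset.expect_le_expect fun σ _ => hR σ).trans (le_of_eq ?_)
    rw [Finset.expect_add_distrib, Finset.expect_div, Fintype.expect_const]
  have hER0 : 0 ≤ 𝔼 σ : G → Bool, supNm Γ (sg σ) :=
    Finset.expect_nonneg fun σ _ => supNm_nonneg _ _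
  have hX0 : 0 ≤ 𝔼 σ : G → Bool, X (m σ) σ := Finset.expect_nonneg fun σ _ => abs_nonneg _
  have hXb : 𝔼 σ : G → Bool, X (m σ) σ ≤ 8 * S + Θ := by
    have e1 : 𝔼 σ : G → Bool, X (m σ) σ ≤ 4 * (D * 𝔼 σ : G → Bool, supNm Γ (sg σ)) := hX
    have e2 : D * 𝔼 σ : G → Bool, supNm Γ (sg σ) ≤
        S * (1 + Θ / 2 + (𝔼 σ : G → Bool, X (m σ) σ) / 2) :=
      mul_le_mul hDS hER hER0 hS0
    nlinarith
  have hpt : ∀ σ : G → Bool, |∑ i, ap (gam c B (sel σ)) (sg σ) i ^ 2 - ∑ t, sel σ t ^ 2| ≤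
      X (m σ) σ + Θ := by
    intro σ
    have e1 := hm σ (some σ)
    have e2 := hF (some σ)
    have e3 := abs_sub_le (∑ i, ap (Γ (some σ)) (sg σ) i ^ 2)
      (∑ t, ∑ s, Γ (some σ) t s ^ 2) (∑ t, Y (some σ) t ^ 2)
    exact e3.trans (add_le_add e1 e2)
  refine (Finset.expect_le_expect fun σ _ => hpt σ).trans ?_
  rw [Finset.expect_add_distrib, Fintype.expect_const]
  linarith

/-- Restricted isometry of `y ↦ c B (σ ∗ y)` on the intersection of the `ℓ²` unit ball with an
`ℓ¹` ball. -/
def Rip (c : ℝ) (B : β → G → ℝ) (σ : G → Bool) (L δ : ℝ) : Prop :=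
  ∀ y : G → ℝ, ∑ t, |y t| ≤ L → ∑ t, y t ^ 2 ≤ 1 →
    |∑ i, ap (gam c B y) (sg σ) i ^ 2 - ∑ t, y t ^ 2| ≤ δ

open Classical in
lemma expect_not_rip_le [Nonempty β] {b : μ → β} {e : μ → G} (he : Function.Injective e)
    {w : μ → ℝ} (hw : ∀ i, ∑ j, (if b j = i then w j ^ 2 else 0) = 1)
    (hn : 2 ≤ Fintype.card G) {L S δ : ℝ} (hL : 0 < L) (hδ : 0 < δ)
    (hS : S = 1512 * (1 / Real.sqrt (Fintype.card β) * L) * Real.log (Fintype.card G) ^ 2)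
    (hS1 : 4 * S ≤ 1) (hp : Real.log (2 * Fintype.card G) ≤ Fintype.card β) :
    𝔼 ε : μ → Bool, 𝔼 σ : G → Bool,
        (if Rip (1 / Real.sqrt (Fintype.card β)) (blk b e w ε) σ L δ then (0 : ℝ) else 1) ≤
      (8 * S + 28 * Real.sqrt (Real.log (2 * Fintype.card G) / Fintype.card β)) / δ := by
  set c := 1 / Real.sqrt (Fintype.card β) with hc
  have hsel : ∀ (ε : μ → Bool) (σ : G → Bool), ∃ y : G → ℝ, ∑ t, |y t| ≤ L ∧ ∑ t, y t ^ 2 ≤ 1 ∧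
      (if Rip c (blk b e w ε) σ L δ then (0 : ℝ) else 1) ≤
        |∑ i, ap (gam c (blk b e w ε) y) (sg σ) i ^ 2 - ∑ t, y t ^ 2| / δ := by
    intro ε σ
    by_cases h : Rip c (blk b e w ε) σ L δ
    · refine ⟨0, by simpa using hL.le, by simp, ?_⟩
      rw [if_pos h]
      exact div_nonneg (abs_nonneg _) hδ.le
    · have h' := h
      simp only [Rip, not_forall, not_le] at h'
      obtain ⟨y, h1, h2, h3⟩ := h'
      refine ⟨y, h1, h2, ?_⟩
      rw [if_neg h, one_le_div hδ]
      exact h3.le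
  choose y hy1 hy2 hy3 using hsel
  calc _ ≤ 𝔼 ε : μ → Bool, (8 * S + 2 * specDev (blk b e w ε)) / δ := by
        refine Finset.expect_le_expect fun ε _ => ?_
        refine (Finset.expect_le_expect fun σ _ => hy3 ε σ).trans ?_
        rw [← Finset.expect_div]
        exact div_le_div_of_nonneg_right
          (expect_rip_le (opLe_blk he hw ε) hn hL hS hS1 (y ε) (hy1 ε) (hy2 ε)) hδ.le
    _ = (8 * S + 2 * 𝔼 ε : μ → Bool, specDev (blk b e w ε)) / δ := by
        rw [← Finset.expect_div, Finset.expect_add_distrib, Fintype.expect_const,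
          Finset.mul_expect]
    _ ≤ _ := by
        refine div_le_div_of_nonneg_right ?_ hδ.le
        have := expect_specDev_le e hw hp
        linarith

open Classical in
lemma expect_not_rip_le_rho [Nonempty β] {b : μ → β} {e : μ → G} (he : Function.Injective e)
    {w : μ → ℝ} (hw : ∀ i, ∑ j, (if b j = i then w j ^ 2 else 0) = 1)
    (hn : 2 ≤ Fintype.card G) {k α ρ K : ℝ} (hk : 80 ≤ k) (hα : 0 < α) (hα1 : α < 1) (hρ : 0 < ρ)
    (hρ1 : ρ < 1) (hK : 1 ≤ K)
    (hp : (13000 * K) ^ 2 * k * Real.log (Fintype.card G) ^ 4 / (α ^ 2 * ρ ^ 2) ≤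
      Fintype.card β) :
    𝔼 ε : μ → Bool, 𝔼 σ : G → Bool, (if Rip (1 / Real.sqrt (Fintype.card β)) (blk b e w ε) σ
      (Real.sqrt k) (α / K) then (0 : ℝ) else 1) ≤ ρ := by
  have hn' : (2 : ℝ) ≤ Fintype.card G := by exact_mod_cast hn
  have hp0 : (0 : ℝ) < Fintype.card β := by exact_mod_cast Fintype.card_pos
  set n : ℝ := ((Fintype.card G : ℕ) : ℝ)
  set p : ℝ := ((Fintype.card β : ℕ) : ℝ)
  have hl2 : 0.69 < Real.log 2 := by have := Real.log_two_gt_d9; linarith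
  have hln : Real.log 2 ≤ Real.log n := Real.log_le_log (by norm_num) hn'
  set ℓ := Real.log n
  have hl2n : Real.log (2 * n) ≤ 2 * ℓ := by
    rw [Real.log_mul (by norm_num) (by linarith)]; linarith
  set q := 1 / Real.sqrt p * Real.sqrt k * ℓ ^ 2 with hq
  have hq0 : 0 ≤ q := by positivity
  have hq2 : q ^ 2 = k * ℓ ^ 4 / p := by
    rw [hq, mul_pow, mul_pow, div_pow, one_pow, Real.sq_sqrt hp0.le, Real.sq_sqrt (by linarith)]
    ring
  have hqb : q ≤ α * ρ / (13000 * K) := by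
    refine (pow_le_pow_iff_left₀ hq0 (by positivity) two_ne_zero).mp ?_
    rw [hq2, div_pow, mul_pow α ρ, div_le_div_iff₀ hp0 (by positivity)]
    rw [div_le_iff₀ (by positivity)] at hp
    linarith
  have hqK : 13000 * q ≤ α * ρ / K := by
    calc 13000 * q ≤ 13000 * (α * ρ / (13000 * K)) := by linarith
      _ = _ := by field_simp
  have hαρ : α * ρ ≤ 1 := by nlinarith
  have hq1 : 13000 * q ≤ 1 := hqK.trans ((div_le_one (by linarith)).mpr (by linarith))
  have hlp : Real.log (2 * n) / p ≤ q ^ 2 := by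
    rw [hq2]
    refine div_le_div_of_nonneg_right (hl2n.trans ?_) hp0.le
    have h3 : (0.69 : ℝ) ^ 3 ≤ ℓ ^ 3 := pow_le_pow_left₀ (by norm_num) (by linarith) 3
    have h4 : 0.69 ^ 3 * ℓ ≤ ℓ ^ 4 := by
      calc _ ≤ ℓ ^ 3 * ℓ := mul_le_mul_of_nonneg_right h3 (by linarith)
        _ = _ := by ring
    norm_num at h4
    nlinarith
  have hlp1 : Real.log (2 * n) ≤ p := by
    have : Real.log (2 * n) / p ≤ 1 := hlp.trans (by nlinarith)
    rwa [div_le_one hp0] at this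
  have hsq : Real.sqrt (Real.log (2 * n) / p) ≤ q := by
    rw [Real.sqrt_le_left hq0]; exact hlp
  have hmain := expect_not_rip_le he hw hn (L := Real.sqrt k) (δ := α / K)
    (Real.sqrt_pos.mpr (by linarith)) (by positivity) rfl
    (show 4 * (1512 * (1 / Real.sqrt p * Real.sqrt k) * ℓ ^ 2) ≤ 1 by
      rw [mul_assoc 1512, ← hq]; linarith) hlp1
  refine hmain.trans ?_
  rw [div_le_iff₀ (by positivity), mul_assoc 1512]
  change 8 * (1512 * q) + 28 * Real.sqrt (Real.log (2 * n) / p) ≤ _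
  calc _ ≤ 13000 * q := by linarith
    _ ≤ _ := hqK
    _ = _ := by ring

end RipExpectation

section SignRandomization

variable {G : Type*} [Fintype G] [DecidableEq G]

lemma sum_sq_le_of_inner_le (a : G → ℝ) {S : ℝ} (hS : 0 ≤ S)
    (h : ∀ z : G → ℝ, nm z = 1 → |∑ t, a t * z t| ≤ S) : ∑ t, a t ^ 2 ≤ S ^ 2 := by
  rw [← nm_sq]
  refine pow_le_pow_left₀ (nm_nonneg a) ?_ 2
  rcases (nm_nonneg a).eq_or_lt with h0 | h0
  · rw [← h0]; exact hS
  · have h1 := h ((nm a)⁻¹ • a) (by rw [nm_smul, abs_of_pos (inv_pos.mpr h0)]; field_simp)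
    have e : ∑ t, a t * ((nm a)⁻¹ • a) t = nm a := by
      simp only [Pi.smul_apply, smul_eq_mul]
      calc _ = (nm a)⁻¹ * ∑ t, a t ^ 2 := by
            rw [Finset.mul_sum]; exact Finset.sum_congr rfl fun _ _ => by ring
        _ = _ := by rw [← nm_sq]; field_simp
    rw [e] at h1
    exact (le_abs_self _).trans h1

lemma opLe_of_inner_le (W : G → G → ℝ) {κ : ℝ} (hκ : 0 ≤ κ)
    (h : ∀ a z : G → ℝ, nm a = 1 → nm z = 1 → |∑ t, ap W a t * z t| ≤ κ) : OpLe W κ := by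
  refine opLe_of_nm_le fun a => ?_
  rcases (nm_nonneg a).eq_or_lt with h0 | h0
  · have h1 : ∑ t, a t ^ 2 = 0 := by rw [← nm_sq, ← h0]; norm_num
    have h2 : ∀ t, a t = 0 := fun t => by
      have := (Finset.sum_eq_zero_iff_of_nonneg fun _ _ => sq_nonneg _).mp h1 t (Finset.mem_univ t)
      exact pow_eq_zero_iff two_ne_zero |>.mp this
    rw [← h0, mul_zero]
    simp [nm, ap, h2]
  · have h1 : nm ((nm a)⁻¹ • a) = 1 := by
      rw [nm_smul, abs_of_pos (inv_pos.mpr h0)]; field_simp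
    have h2 := sum_sq_le_of_inner_le (ap W ((nm a)⁻¹ • a)) hκ (fun z hz => h _ z h1 hz)
    rw [← nm_le_iff _ hκ, ap_smul_right, nm_smul, abs_of_pos (inv_pos.mpr h0),
      inv_mul_le_iff₀ h0] at h2
    linarith

/-- Joint bound on the `ℓ²` norm and the normalized `ℓ¹` norm. -/
def MixLe (k : ℝ) (y : G → ℝ) (N : ℝ) : Prop :=
  ∑ t, y t ^ 2 ≤ N ^ 2 ∧ ∑ t, |y t| ≤ Real.sqrt k * N

lemma MixLe.smul {k : ℝ} {y : G → ℝ} {N : ℝ} (h : MixLe k y N) (c : ℝ) :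
    MixLe k (c • y) (|c| * N) := by
  constructor
  · simp only [Pi.smul_apply, smul_eq_mul, mul_pow, ← Finset.mul_sum, sq_abs]
    exact mul_le_mul_of_nonneg_left h.1 (sq_nonneg c)
  · simp only [Pi.smul_apply, smul_eq_mul, abs_mul, ← Finset.mul_sum]
    rw [mul_left_comm]
    exact mul_le_mul_of_nonneg_left h.2 (abs_nonneg c)

lemma MixLe.add {k : ℝ} {y z : G → ℝ} (hy : MixLe k y 1) (hz : MixLe k z 1) :
    MixLe k (y + z) 2 := by
  constructor
  · have : ∑ t, (y + z) t ^ 2 ≤ ∑ t, (2 * y t ^ 2 + 2 * z t ^ 2) :=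
      Finset.sum_le_sum fun t _ => by
        simp only [Pi.add_apply]; nlinarith [sq_nonneg (y t - z t)]
    rw [Finset.sum_add_distrib, ← Finset.mul_sum, ← Finset.mul_sum] at this
    have := hy.1
    have := hz.1
    linarith
  · have : ∑ t, |(y + z) t| ≤ ∑ t, (|y t| + |z t|) := Finset.sum_le_sum fun t _ => abs_add_le _ _
    rw [Finset.sum_add_distrib] at this
    have := hy.2
    have := hz.2
    linarith

lemma MixLe.sub {k : ℝ} {y z : G → ℝ} (hy : MixLe k y 1) (hz : MixLe k z 1) :
    MixLe k (y - z) 2 := by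
  have h := hz.smul (-1)
  rw [abs_neg, abs_one, one_mul] at h
  simpa [sub_eq_add_neg] using hy.add h

variable {M : Matrix G G ℝ} {k δ : ℝ}

lemma abs_bilin_le (hM : M.IsSymm) (hδ : ∀ y, MixLe k y 1 → |y ⬝ᵥ M *ᵥ y| ≤ δ) {y z : G → ℝ}
    {N₁ N₂ : ℝ} (h₁ : 0 < N₁) (h₂ : 0 < N₂) (hy : MixLe k y N₁) (hz : MixLe k z N₂) :
    |y ⬝ᵥ M *ᵥ z| ≤ 2 * δ * (N₁ * N₂) := by
  have key : ∀ y z : G → ℝ, MixLe k y 1 → MixLe k z 1 → |y ⬝ᵥ M *ᵥ z| ≤ 2 * δ := by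
    intro y z hy hz
    have h1 := hδ ((1 / 2 : ℝ) • (y + z)) (by
      have := (hy.add hz).smul (1 / 2); norm_num at this; simpa using this)
    have h2 := hδ ((1 / 2 : ℝ) • (y - z)) (by
      have := (hy.sub hz).smul (1 / 2); norm_num at this; simpa using this)
    have hs : z ⬝ᵥ M *ᵥ y = y ⬝ᵥ M *ᵥ z := by
      rw [Matrix.dotProduct_mulVec, ← Matrix.mulVec_transpose, hM.eq, dotProduct_comm]
    have e : y ⬝ᵥ M *ᵥ z = ((1 / 2 : ℝ) • (y + z)) ⬝ᵥ M *ᵥ ((1 / 2 : ℝ) • (y + z)) -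
        ((1 / 2 : ℝ) • (y - z)) ⬝ᵥ M *ᵥ ((1 / 2 : ℝ) • (y - z)) := by
      simp only [Matrix.mulVec_smul, Matrix.mulVec_add, Matrix.mulVec_sub, smul_dotProduct,
        dotProduct_smul, add_dotProduct, dotProduct_add, sub_dotProduct, dotProduct_sub, hs,
        smul_eq_mul]
      ring
    rw [e]
    exact (abs_sub _ _).trans (by linarith)
  have hy' := hy.smul N₁⁻¹
  have hz' := hz.smul N₂⁻¹
  rw [abs_of_pos (inv_pos.mpr h₁), inv_mul_cancel₀ h₁.ne'] at hy'
  rw [abs_of_pos (inv_pos.mpr h₂), inv_mul_cancel₀ h₂.ne'] at hz'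
  have h := key _ _ hy' hz'
  simp only [Matrix.mulVec_smul, smul_dotProduct, dotProduct_smul, smul_eq_mul] at h
  rw [← mul_assoc, abs_mul, abs_of_pos (by positivity), ← mul_inv,
    inv_mul_le_iff₀ (by positivity)] at h
  linarith

lemma mixLe_flat_mul (hk : 0 < k) {x z : G → ℝ} (hx : ∀ t, |x t| ≤ 1 / Real.sqrt k)
    (hx2 : ∑ t, x t ^ 2 ≤ 1) (hz : nm z = 1) : MixLe k (x * z) (1 / Real.sqrt k) := by
  have hs : 0 < Real.sqrt k := Real.sqrt_pos.mpr hk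
  have hz2 : ∑ t, z t ^ 2 = 1 := by rw [← nm_sq, hz, one_pow]
  constructor
  · calc _ ≤ ∑ t, (1 / Real.sqrt k) ^ 2 * z t ^ 2 := Finset.sum_le_sum fun t _ => by
          simp only [Pi.mul_apply, mul_pow]
          refine mul_le_mul_of_nonneg_right ?_ (sq_nonneg _)
          rw [← sq_abs]
          exact pow_le_pow_left₀ (abs_nonneg _) (hx t) 2
      _ = _ := by rw [← Finset.mul_sum, hz2, mul_one]
  · rw [mul_one_div_cancel hs.ne']
    have h := abs_inner_le (fun t => |x t|) (fun t => |z t|)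
    have e1 : nm (fun t => |x t|) ≤ 1 := by rw [nm_le_iff _ zero_le_one]; simpa using hx2
    have e2 : nm (fun t => |z t|) = 1 := by rw [← hz]; simp [nm]
    rw [e2, mul_one] at h
    calc _ = ∑ t, |x t| * |z t| := Finset.sum_congr rfl fun t _ => by simp [abs_mul]
      _ ≤ _ := (le_abs_self _).trans (h.trans e1)

lemma mixLe_single (hk : 1 ≤ k) (s : G) : MixLe k (Pi.single s (1 : ℝ)) 1 := by
  constructor
  · simp [Pi.single_apply, ite_pow]
  · simp only [Pi.single_apply, apply_ite abs, abs_one, abs_zero, Finset.sum_ite_eq',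
      Finset.mem_univ, if_true, mul_one]
    exact Real.one_le_sqrt.mpr hk

lemma expect_exp_flat_chaos_le (hM : M.IsSymm) (hk : 1 ≤ k)
    (hδ : ∀ y, MixLe k y 1 → |y ⬝ᵥ M *ᵥ y| ≤ δ) {x : G → ℝ} (hx : ∀ t, |x t| ≤ 1 / Real.sqrt k)
    (hx2 : ∑ t, x t ^ 2 ≤ 1) (hδ0 : 0 ≤ δ) {θ : ℝ} (hθ : |θ| * (2 * δ / k) ≤ 1 / 12) :
    𝔼 σ : G → Bool, Real.exp (θ * ∑ s, ∑ t,
      (if s = t then 0 else x s * M s t * x t * sg σ s * sg σ t)) ≤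
      Real.exp (64 * θ ^ 2 * δ ^ 2 / k) := by
  have hk0 : 0 < k := by linarith
  have hs : 0 < Real.sqrt k := Real.sqrt_pos.mpr hk0
  have hs2 : Real.sqrt k ^ 2 = k := Real.sq_sqrt hk0.le
  set W : G → G → ℝ := fun s t => θ * (x s * M s t * x t) with hW
  have hop : OpLe W (|θ| * (2 * δ / k)) := by
    refine opLe_of_inner_le W (by positivity) fun a z ha hz => ?_
    have h := abs_bilin_le hM hδ (by positivity) (by positivity)
      (mixLe_flat_mul hk0 hx hx2 hz) (mixLe_flat_mul hk0 hx hx2 ha)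
    have e : ∑ t, ap W a t * z t = θ * ((x * z) ⬝ᵥ M *ᵥ (x * a)) := by
      simp only [ap, hW, dotProduct, Matrix.mulVec, Finset.sum_mul, Finset.mul_sum, Pi.mul_apply]
      exact Finset.sum_congr rfl fun _ _ => Finset.sum_congr rfl fun _ _ => by ring
    rw [e, abs_mul]
    refine mul_le_mul_of_nonneg_left (h.trans (le_of_eq ?_)) (abs_nonneg θ)
    calc _ = 2 * δ / Real.sqrt k ^ 2 := by field_simp
      _ = _ := by rw [hs2]
  have h := expect_exp_chaos_le W _ (by positivity) hθ hop
  have hcol : ∀ s, ∑ t, (M s t * x t) ^ 2 ≤ (2 * δ / Real.sqrt k) ^ 2 := by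
    intro s
    refine sum_sq_le_of_inner_le _ (by positivity) fun z hz => ?_
    have h := abs_bilin_le hM hδ one_pos (by positivity) (mixLe_single hk s)
      (mixLe_flat_mul hk0 hx hx2 hz)
    have e : ∑ t, M s t * x t * z t = (Pi.single s (1 : ℝ)) ⬝ᵥ M *ᵥ (x * z) := by
      rw [single_dotProduct, one_mul]
      simp only [Matrix.mulVec, dotProduct, Pi.mul_apply]
      exact Finset.sum_congr rfl fun _ _ => by ring
    rw [e]
    exact h.trans (le_of_eq (by ring))
  have hF : ∑ s, ∑ t, W s t ^ 2 ≤ θ ^ 2 * (2 * δ / Real.sqrt k) ^ 2 := by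
    calc _ = ∑ s, θ ^ 2 * x s ^ 2 * ∑ t, (M s t * x t) ^ 2 := by
          simp only [hW, Finset.mul_sum]
          exact Finset.sum_congr rfl fun _ _ => Finset.sum_congr rfl fun _ _ => by ring
      _ ≤ ∑ s, θ ^ 2 * x s ^ 2 * (2 * δ / Real.sqrt k) ^ 2 :=
          Finset.sum_le_sum fun s _ => mul_le_mul_of_nonneg_left (hcol s) (by positivity)
      _ = (∑ s, x s ^ 2) * (θ ^ 2 * (2 * δ / Real.sqrt k) ^ 2) := by
          rw [Finset.sum_mul]; exact Finset.sum_congr rfl fun _ _ => by ring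
      _ ≤ _ := mul_le_of_le_one_left (by positivity) hx2
  calc _ = 𝔼 σ : G → Bool, Real.exp (∑ s, ∑ t,
        (if s = t then 0 else W s t * sg σ s * sg σ t)) := by
        refine Finset.expect_congr rfl fun σ _ => ?_
        simp only [Finset.mul_sum, mul_ite, mul_zero, hW, mul_assoc]
    _ ≤ _ := h
    _ ≤ _ := by
        refine Real.exp_le_exp.mpr ?_
        rw [div_pow, hs2] at hF
        calc _ ≤ 16 * (θ ^ 2 * ((2 * δ) ^ 2 / k)) := by linarith
          _ = _ := by ring

lemma expect_exp_cross_le (hM : M.IsSymm) (hk : 1 ≤ k)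
    (hδ : ∀ y, MixLe k y 1 → |y ⬝ᵥ M *ᵥ y| ≤ δ) {x : G → ℝ} (b : G → Bool)
    (hxI : MixLe k (mask b x) 1) (hx : ∀ t, |mask (cosel b) x t| ≤ 1 / Real.sqrt k)
    (hx2 : ∑ t, mask (cosel b) x t ^ 2 ≤ 1) (hδ0 : 0 ≤ δ) (θ : ℝ) :
    𝔼 σ : G → Bool, Real.exp (θ * (2 * ((mask b (sg σ) * x) ⬝ᵥ M *ᵥ (mask (cosel b) (sg σ) * x)))) ≤
      Real.exp (8 * θ ^ 2 * δ ^ 2 / k) := by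
  have hk0 : 0 < k := by linarith
  have hs : 0 < Real.sqrt k := Real.sqrt_pos.mpr hk0
  have hs2 : Real.sqrt k ^ 2 = k := Real.sq_sqrt hk0.le
  rw [expect_mask_indep b (fun u v => Real.exp (θ * (2 * ((u * x) ⬝ᵥ M *ᵥ (v * x)))))]
  refine Finset.expect_le Finset.univ_nonempty fun σ _ => ?_
  set u := mask b (sg σ) * x with hu
  have humix : MixLe k u 1 := by
    have e : ∀ t, |u t| = |mask b x t| := by
      intro t
      by_cases h : b t = true <;> simp [hu, mask, h, abs_mul, abs_sg]
    refine ⟨?_, ?_⟩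
    · simp only [← sq_abs (u _), e, sq_abs]; exact hxI.1
    · simp only [e]; exact hxI.2
  set a : G → ℝ := fun t => θ * 2 * (mask (cosel b) x t * (u ᵥ* M) t) with ha
  have e : ∀ τ : G → Bool, θ * (2 * (u ⬝ᵥ M *ᵥ (mask (cosel b) (sg τ) * x))) =
      ∑ t, a t * sg τ t := by
    intro τ
    rw [Matrix.dotProduct_mulVec]
    simp only [dotProduct, ha, Finset.mul_sum, Pi.mul_apply]
    refine Finset.sum_congr rfl fun t _ => ?_
    by_cases h : cosel b t = true <;> simp only [mask, h, if_true]
    · ring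
    · simp
  simp only [e]
  refine (expect_exp_le a).trans (Real.exp_le_exp.mpr ?_)
  have h1 : ∑ t, (mask (cosel b) x t * (u ᵥ* M) t) ^ 2 ≤ (2 * δ / Real.sqrt k) ^ 2 := by
    refine sum_sq_le_of_inner_le _ (by positivity) fun z hz => ?_
    have h := abs_bilin_le hM hδ one_pos (by positivity) humix (mixLe_flat_mul hk0 hx hx2 hz)
    rw [Matrix.dotProduct_mulVec] at h
    refine (le_of_eq ?_).trans (h.trans (le_of_eq (by ring)))
    congr 1
    simp only [dotProduct, Pi.mul_apply]
    exact Finset.sum_congr rfl fun _ _ => by ring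
  rw [div_pow, hs2] at h1
  have h2 : ∑ t, a t ^ 2 = (θ * 2) ^ 2 * ∑ t, (mask (cosel b) x t * (u ᵥ* M) t) ^ 2 := by
    rw [Finset.mul_sum]; exact Finset.sum_congr rfl fun _ _ => by simp only [ha]; ring
  rw [h2]
  have h3 := mul_le_mul_of_nonneg_left h1 (sq_nonneg (θ * 2))
  calc _ ≤ (θ * 2) ^ 2 * ((2 * δ) ^ 2 / k) / 2 := by linarith
    _ = _ := by ring

end SignRandomization

section SignRandomizedTail

variable {G : Type*} [Fintype G] [DecidableEq G] {M : Matrix G G ℝ} {k : ℝ}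

lemma abs_diag_le {δ : ℝ} (hk : 1 ≤ k) (hδ : ∀ y, MixLe k y 1 → |y ⬝ᵥ M *ᵥ y| ≤ δ) (s : G) :
    |M s s| ≤ δ := by
  have h := hδ _ (mixLe_single hk s)
  rwa [single_dotProduct, one_mul, Matrix.mulVec_single_one, Matrix.col_apply] at h

lemma mixLe_mask_large (hk : 0 < k) {x : G → ℝ} (hx : ∑ t, x t ^ 2 ≤ 1) :
    MixLe k (mask (fun t => decide (1 / Real.sqrt k < |x t|)) x) 1 := by
  have hs : 0 < Real.sqrt k := Real.sqrt_pos.mpr hk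
  refine ⟨(sum_mask_sq_le _ x).trans (by simpa using hx), ?_⟩
  calc _ ≤ ∑ t, Real.sqrt k * x t ^ 2 := Finset.sum_le_sum fun t _ => by
        by_cases h : 1 / Real.sqrt k < |x t|
        · simp only [mask, h, decide_true, if_true]
          rw [div_lt_iff₀ hs] at h
          rw [← sq_abs]
          nlinarith [abs_nonneg (x t)]
        · simp only [mask, h, decide_false]
          simp only [Bool.false_eq_true, if_false, abs_zero]
          positivity
    _ ≤ _ := by
        rw [← Finset.mul_sum]
        exact mul_le_mul_of_nonneg_left hx hs.le

lemma abs_mask_small_le (hk : 0 < k) (x : G → ℝ) (t : G) :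
    |mask (cosel fun t => decide (1 / Real.sqrt k < |x t|)) x t| ≤ 1 / Real.sqrt k := by
  by_cases h : 1 / Real.sqrt k < |x t|
  · simp only [mask, cosel, h, decide_true, Bool.not_true, Bool.false_eq_true, if_false, abs_zero]
    positivity
  · simp only [mask, cosel, h, decide_false, Bool.not_false, if_true]
    exact not_lt.mp h

lemma quad_eq_diag_add_offdiag (x a : G → ℝ) (ha : ∀ t, a t ^ 2 = 1) :
    (a * x) ⬝ᵥ M *ᵥ (a * x) = ∑ s, M s s * x s ^ 2 +
      ∑ s, ∑ t, (if s = t then 0 else x s * M s t * x t * a s * a t) := by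
  rw [← Finset.sum_add_distrib]
  simp only [dotProduct, Matrix.mulVec, Finset.mul_sum, Pi.mul_apply]
  refine Finset.sum_congr rfl fun s _ => ?_
  have : M s s * x s ^ 2 = ∑ t, if s = t then M s t * x t ^ 2 else 0 := by simp
  rw [this, ← Finset.sum_add_distrib]
  refine Finset.sum_congr rfl fun t _ => ?_
  split_ifs with h
  · subst h
    calc _ = a s ^ 2 * (M s s * x s ^ 2) := by ring
      _ = _ := by rw [ha]; ring
  · ring

/-- Exponential tail of a quadratic form that is small on vectors of small mixed norm, after
randomizing the signs of a fixed unit vector. -/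
lemma expect_quad_tail_le (hM : M.IsSymm) (hk : 1 ≤ k) {α : ℝ} (hα : 0 < α)
    (hδ : ∀ y, MixLe k y 1 → |y ⬝ᵥ M *ᵥ y| ≤ α / 32) {x : G → ℝ} (hx : ∑ t, x t ^ 2 ≤ 1) :
    𝔼 σ : G → Bool, (if α < |(sg σ * x) ⬝ᵥ M *ᵥ (sg σ * x)| then (1 : ℝ) else 0) ≤
      4 * Real.exp (-(3 * k / 16)) := by
  have hk0 : 0 < k := by linarith
  set b : G → Bool := fun t => decide (1 / Real.sqrt k < |x t|) with hb
  have hI : MixLe k (mask b x) 1 := mixLe_mask_large hk0 hx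
  have hJ : ∀ t, |mask (cosel b) x t| ≤ 1 / Real.sqrt k := abs_mask_small_le hk0 x
  have hJ2 : ∑ t, mask (cosel b) x t ^ 2 ≤ 1 := (sum_mask_sq_le _ x).trans hx
  set X : (G → Bool) → ℝ := fun σ => 2 * ((mask b (sg σ) * x) ⬝ᵥ M *ᵥ (mask (cosel b) (sg σ) * x))
    with hX
  set Y : (G → Bool) → ℝ := fun σ => ∑ s, ∑ t, (if s = t then 0 else
    mask (cosel b) x s * M s t * mask (cosel b) x t * sg σ s * sg σ t) with hY
  have hdecomp : ∀ σ, |(sg σ * x) ⬝ᵥ M *ᵥ (sg σ * x)| ≤ α / 16 + |X σ| + |Y σ| := by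
    intro σ
    set u := mask b (sg σ) * x with hu
    set v := mask (cosel b) (sg σ) * x with hv
    have huv : sg σ * x = u + v := by rw [hu, hv, ← add_mul, mask_add_mask_cosel]
    have hsym : v ⬝ᵥ M *ᵥ u = u ⬝ᵥ M *ᵥ v := by
      rw [Matrix.dotProduct_mulVec, ← Matrix.mulVec_transpose, hM.eq, dotProduct_comm]
    have hE : (sg σ * x) ⬝ᵥ M *ᵥ (sg σ * x) = u ⬝ᵥ M *ᵥ u + X σ + v ⬝ᵥ M *ᵥ v := by
      rw [huv]
      simp only [Matrix.mulVec_add, add_dotProduct, dotProduct_add, hsym, hX]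
      ring
    have hv' : v = sg σ * mask (cosel b) x := by
      funext t; by_cases h : cosel b t = true <;> simp [hv, mask, h]
    have hV : v ⬝ᵥ M *ᵥ v = ∑ s, M s s * mask (cosel b) x s ^ 2 + Y σ := by
      rw [hv', quad_eq_diag_add_offdiag _ _ (sg_sq σ)]
    have hD : |∑ s, M s s * mask (cosel b) x s ^ 2| ≤ α / 32 := by
      calc _ ≤ ∑ s, |M s s * mask (cosel b) x s ^ 2| := Finset.abs_sum_le_sum_abs _ _
        _ ≤ ∑ s, α / 32 * mask (cosel b) x s ^ 2 := Finset.sum_le_sum fun s _ => by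
            rw [abs_mul, abs_of_nonneg (sq_nonneg (mask (cosel b) x s))]
            exact mul_le_mul_of_nonneg_right (abs_diag_le hk hδ s) (sq_nonneg _)
        _ ≤ _ := by
            rw [← Finset.mul_sum]
            exact mul_le_of_le_one_right (by positivity) hJ2
    have hU : |u ⬝ᵥ M *ᵥ u| ≤ α / 32 := by
      refine hδ u ?_
      have e : ∀ t, |u t| = |mask b x t| := by
        intro t
        by_cases h : b t = true <;> simp [hu, mask, h, abs_mul, abs_sg]
      refine ⟨?_, ?_⟩
      · simp only [← sq_abs (u _), e, sq_abs]; exact hI.1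
      · simp only [e]; exact hI.2
    rw [hE, hV]
    have h1 := abs_add_le (u ⬝ᵥ M *ᵥ u + X σ) (∑ s, M s s * mask (cosel b) x s ^ 2 + Y σ)
    have h2 := abs_add_le (u ⬝ᵥ M *ᵥ u) (X σ)
    have h3 := abs_add_le (∑ s, M s s * mask (cosel b) x s ^ 2) (Y σ)
    linarith
  set θ := k / α with hθ
  have hθ0 : 0 < θ := by positivity
  have hθα : θ * α = k := by rw [hθ]; field_simp
  have hlarge : ∀ z : ℝ, α / 4 < |z| →
      1 ≤ Real.exp (-(k / 4)) * (Real.exp (θ * z) + Real.exp (-θ * z)) := by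
    intro z hz
    have h1 : Real.exp (k / 4) ≤ Real.exp (θ * z) + Real.exp (-θ * z) := by
      have h2 : k / 4 ≤ θ * |z| := by nlinarith
      have h3 : Real.exp (k / 4) ≤ Real.exp (θ * |z|) := Real.exp_le_exp.mpr h2
      have := Real.exp_pos (θ * z)
      have := Real.exp_pos (-θ * z)
      rcases abs_cases z with ⟨h, _⟩ | ⟨h, _⟩ <;> rw [h] at h3
      · linarith
      · rw [mul_neg, ← neg_mul] at h3; linarith
    calc (1 : ℝ) = Real.exp (-(k / 4)) * Real.exp (k / 4) := by rw [← Real.exp_add]; simp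
      _ ≤ _ := mul_le_mul_of_nonneg_left h1 (Real.exp_pos _).le
  have hpt : ∀ σ : G → Bool, (if α < |(sg σ * x) ⬝ᵥ M *ᵥ (sg σ * x)| then (1 : ℝ) else 0) ≤
      Real.exp (-(k / 4)) * ((Real.exp (θ * X σ) + Real.exp (-θ * X σ)) +
        (Real.exp (θ * Y σ) + Real.exp (-θ * Y σ))) := by
    intro σ
    split_ifs with h
    · rw [mul_add]
      have hx0 : 0 ≤ Real.exp (-(k / 4)) * (Real.exp (θ * X σ) + Real.exp (-θ * X σ)) := by
        positivity
      have hy0 : 0 ≤ Real.exp (-(k / 4)) * (Real.exp (θ * Y σ) + Real.exp (-θ * Y σ)) := by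
        positivity
      have hd := hdecomp σ
      by_cases hc : α / 4 < |X σ|
      · linarith [hlarge _ hc]
      · linarith [hlarge (Y σ) (by linarith)]
    · positivity
  have hX1 : ∀ η : ℝ, |η| = θ → 𝔼 σ, Real.exp (η * X σ) ≤ Real.exp (k / 16) := by
    intro η hη
    refine (expect_exp_cross_le hM hk hδ b hI hJ hJ2 (by positivity) η).trans
      (Real.exp_le_exp.mpr ?_)
    rw [← sq_abs, hη, hθ]
    field_simp
    norm_num
  have hY1 : ∀ η : ℝ, |η| = θ → 𝔼 σ, Real.exp (η * Y σ) ≤ Real.exp (k / 16) := by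
    intro η hη
    refine (expect_exp_flat_chaos_le hM hk hδ hJ hJ2 (by positivity) ?_).trans
      (Real.exp_le_exp.mpr ?_)
    · rw [hη, hθ]; field_simp; norm_num
    · rw [← sq_abs, hη, hθ]
      field_simp
      norm_num
  calc _ ≤ 𝔼 σ : G → Bool, Real.exp (-(k / 4)) * ((Real.exp (θ * X σ) + Real.exp (-θ * X σ)) +
        (Real.exp (θ * Y σ) + Real.exp (-θ * Y σ))) := Finset.expect_le_expect fun σ _ => hpt σ
    _ = Real.exp (-(k / 4)) * (((𝔼 σ, Real.exp (θ * X σ)) + 𝔼 σ, Real.exp (-θ * X σ)) +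
        ((𝔼 σ, Real.exp (θ * Y σ)) + 𝔼 σ, Real.exp (-θ * Y σ))) := by
        rw [← Finset.mul_expect, Finset.expect_add_distrib, Finset.expect_add_distrib,
          Finset.expect_add_distrib]
    _ ≤ Real.exp (-(k / 4)) * ((Real.exp (k / 16) + Real.exp (k / 16)) +
        (Real.exp (k / 16) + Real.exp (k / 16))) := by
        refine mul_le_mul_of_nonneg_left ?_ (Real.exp_pos _).le
        have a1 : |θ| = θ := abs_of_pos hθ0
        have a2 : |-θ| = θ := by rw [abs_neg, a1]
        exact add_le_add (add_le_add (hX1 _ a1) (hX1 _ a2)) (add_le_add (hY1 _ a1) (hY1 _ a2))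
    _ = 4 * (Real.exp (-(k / 4)) * Real.exp (k / 16)) := by ring
    _ = _ := by rw [← Real.exp_add]; ring_nf

end SignRandomizedTail

section FiniteSetEmbedding

variable {G : Type*} [AddCommGroup G] [Fintype G] [DecidableEq G]
variable {β : Type*} [Fintype β]

/-- The matrix of `y ↦ c B (σ ∗ y)` for a sign vector `σ`. -/
def convMat (c : ℝ) (B : β → G → ℝ) (σ : G → Bool) : Matrix β G ℝ :=
  Matrix.of fun i t => c * ∑ j, B i j * sg σ (j - t)

lemma convMat_mulVec (c : ℝ) (B : β → G → ℝ) (σ : G → Bool) (y : G → ℝ) :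
    convMat c B σ *ᵥ y = ap (gam c B y) (sg σ) := by
  funext i
  simp only [Matrix.mulVec, dotProduct, convMat, Matrix.of_apply, ap, gam, Finset.mul_sum,
    Finset.sum_mul]
  rw [Finset.sum_comm]
  conv_rhs => rw [Finset.sum_comm]
  refine Finset.sum_congr rfl fun j _ => ?_
  refine Fintype.sum_equiv (Equiv.subLeft j) _ _ fun t => ?_
  simp only [Equiv.subLeft_apply, sub_sub_cancel]
  ring

lemma abs_sub_le_of_abs_sq_sub_le {a z α : ℝ} (ha : 0 ≤ a) (hz : 0 < z)
    (h : |a ^ 2 - z ^ 2| ≤ α * z ^ 2) : |a - z| ≤ α * z := by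
  have e : a ^ 2 - z ^ 2 = (a - z) * (a + z) := by ring
  rw [e, abs_mul, abs_of_pos (show 0 < a + z by linarith)] at h
  nlinarith [mul_nonneg (abs_nonneg (a - z)) ha]

open Classical in
lemma expect_not_preserved_le {c : ℝ} {B : β → G → ℝ} {σ : G → Bool} {k α : ℝ} (hk : 1 ≤ k)
    (hα : 0 < α) (h : Rip c B σ (Real.sqrt k) (α / 32)) (x : G → ℝ) :
    𝔼 τ : G → Bool, (if |nm (convMat c B σ *ᵥ (sg τ * x)) - nm x| ≤ α * nm x then (0 : ℝ) else 1) ≤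
      4 * Real.exp (-(3 * k / 16)) := by
  rcases (nm_nonneg x).eq_or_lt with h0 | h0
  · have hx : x = 0 := by
      have h1 : ∑ t, x t ^ 2 = 0 := by rw [← nm_sq, ← h0]; norm_num
      funext t
      have := (Finset.sum_eq_zero_iff_of_nonneg fun _ _ => sq_nonneg _).mp h1 t (Finset.mem_univ t)
      exact pow_eq_zero_iff two_ne_zero |>.mp this
    subst hx
    simp [nm]
    positivity
  set A := convMat c B σ with hA
  set M : Matrix G G ℝ := Aᵀ * A - 1 with hM
  have hsymm : M.IsSymm := by
    rw [Matrix.IsSymm, hM, Matrix.transpose_sub, Matrix.transpose_mul, Matrix.transpose_transpose,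
      Matrix.transpose_one]
  have hquad : ∀ y : G → ℝ, y ⬝ᵥ M *ᵥ y = nm (A *ᵥ y) ^ 2 - nm y ^ 2 := by
    intro y
    rw [hM, Matrix.sub_mulVec, dotProduct_sub, Matrix.one_mulVec, ← Matrix.mulVec_mulVec,
      Matrix.dotProduct_mulVec, Matrix.vecMul_transpose, nm_sq, nm_sq]
    simp only [dotProduct, sq]
  have hδ : ∀ y, MixLe k y 1 → |y ⬝ᵥ M *ᵥ y| ≤ α / 32 := by
    intro y hy
    rw [hquad, nm_sq, nm_sq, hA, convMat_mulVec]
    exact h y (by simpa using hy.2) (by simpa using hy.1)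
  have hz : nm ((nm x)⁻¹ • x) = 1 := by
    rw [nm_smul, abs_of_pos (inv_pos.mpr h0), inv_mul_cancel₀ h0.ne']
  refine le_trans (Finset.expect_le_expect fun τ _ => ?_)
    (expect_quad_tail_le hsymm hk hα hδ (x := (nm x)⁻¹ • x) (by rw [← nm_sq, hz]; norm_num))
  by_cases hc : α < |(sg τ * (nm x)⁻¹ • x) ⬝ᵥ M *ᵥ (sg τ * (nm x)⁻¹ • x)|
  · rw [if_pos hc]; split_ifs <;> norm_num
  · rw [if_neg hc, if_pos]
    refine abs_sub_le_of_abs_sq_sub_le (nm_nonneg _) h0 ?_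
    rw [not_lt, mul_smul_comm, Matrix.mulVec_smul, smul_dotProduct, dotProduct_smul, hquad,
      smul_eq_mul, smul_eq_mul, ← mul_assoc, abs_mul, abs_of_pos (by positivity), ← mul_inv,
      inv_mul_le_iff₀ (by positivity)] at hc
    have hs : nm (sg τ * x) = nm x := by simp [nm, mul_pow, sg_sq]
    rw [hs] at hc
    linarith

/-- The matrix `A`, precomposed with the sign vector `τ`, nearly preserves the distances in `T`. -/
def NearIso (A : Matrix β G ℝ) (T : Finset (G → ℝ)) (α : ℝ) (τ : G → Bool) : Prop :=
  ∀ x ∈ T, ∀ x' ∈ T, |nm (A *ᵥ (sg τ * (x - x'))) - nm (x - x')| ≤ α * nm (x - x')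

open Classical in
lemma expect_not_embedding_le {c : ℝ} {B : β → G → ℝ} {σ : G → Bool} {k α ν : ℝ}
    (hα : 0 < α) (h : Rip c B σ (Real.sqrt k) (α / 32)) (hν : 0 < ν) {T : Finset (G → ℝ)}
    (hT : T.Nonempty) (hk1 : 1 ≤ k) (hk : 40 * (Real.log (8 * (T.card : ℝ)) + ν) ≤ k) :
    𝔼 τ : G → Bool, (if NearIso (convMat c B σ) T α τ then (0 : ℝ) else 1) ≤ Real.exp (-ν) := by
  have hN : (1 : ℝ) ≤ T.card := by exact_mod_cast hT.card_pos
  set P : (G → Bool) → (G → ℝ) × (G → ℝ) → Prop := fun τ q =>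
    |nm (convMat c B σ *ᵥ (sg τ * (q.1 - q.2))) - nm (q.1 - q.2)| ≤ α * nm (q.1 - q.2) with hP
  calc _ ≤ 𝔼 τ : G → Bool, ∑ q ∈ T ×ˢ T, (if P τ q then (0 : ℝ) else 1) := by
        refine Finset.expect_le_expect fun τ _ => ?_
        have hnn : ∀ q ∈ T ×ˢ T, (0 : ℝ) ≤ if P τ q then (0 : ℝ) else 1 := by
          intro q _; split_ifs <;> norm_num
        split_ifs with hc
        · exact Finset.sum_nonneg hnn
        · unfold NearIso at hc
          push Not at hc
          obtain ⟨x, hx, x', hx', hlt⟩ := hc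
          have := Finset.single_le_sum hnn (Finset.mk_mem_product hx hx')
          rwa [if_neg (not_le.mpr hlt)] at this
    _ = ∑ q ∈ T ×ˢ T, 𝔼 τ : G → Bool, (if P τ q then (0 : ℝ) else 1) :=
        Finset.expect_sum_comm _ _ _
    _ ≤ ∑ q ∈ T ×ˢ T, 4 * Real.exp (-(3 * k / 16)) :=
        Finset.sum_le_sum fun q _ => expect_not_preserved_le hk1 hα h _
    _ = 4 * (T.card : ℝ) ^ 2 * Real.exp (-(3 * k / 16)) := by
        rw [Finset.sum_const, Finset.card_product, nsmul_eq_mul]; push_cast; ring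
    _ ≤ 4 * (T.card : ℝ) ^ 2 * Real.exp (-(2 * Real.log (8 * (T.card : ℝ)) + ν)) := by
        refine mul_le_mul_of_nonneg_left (Real.exp_le_exp.mpr ?_) (by positivity)
        have : 0 ≤ Real.log (8 * (T.card : ℝ)) := Real.log_nonneg (by linarith)
        linarith
    _ = 4 * (T.card : ℝ) ^ 2 * ((8 * (T.card : ℝ)) ^ 2)⁻¹ * Real.exp (-ν) := by
        have e : Real.exp (2 * Real.log (8 * (T.card : ℝ))) = (8 * (T.card : ℝ)) ^ 2 := by
          rw [two_mul, Real.exp_add, Real.exp_log (by positivity), sq]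
        rw [neg_add, Real.exp_add, Real.exp_neg, e]
        ring
    _ ≤ _ := by
        refine mul_le_of_le_one_left (Real.exp_pos _).le ?_
        field_simp
        norm_num

end FiniteSetEmbedding

section NoiseShaping

open Polynomial

/-- Forward shift on bi-infinite real sequences. -/
def fwd : Module.End ℝ (ℤ → ℝ) := LinearMap.funLeft ℝ ℝ (· + 1)

/-- Backward difference on bi-infinite real sequences. -/
def bdiff : Module.End ℝ (ℤ → ℝ) := 1 - LinearMap.funLeft ℝ ℝ (· - 1)

lemma bdiff_apply (U : ℤ → ℝ) (s : ℤ) : bdiff U s = U s - U (s - 1) := rfl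

lemma fwd_pow_apply (j : ℕ) (U : ℤ → ℝ) (s : ℤ) : (fwd ^ j) U s = U (s + j) := by
  induction j generalizing s with
  | zero => simp
  | succ j ih =>
    rw [pow_succ', Module.End.mul_apply]
    change (fwd ^ j) U (s + 1) = _
    rw [ih]; congr 1; push_cast; ring

lemma fwd_mul_bdiff : fwd * bdiff = fwd - 1 := by
  refine LinearMap.ext fun U => funext fun s => ?_
  change U (s + 1) - U (s + 1 - 1) = U (s + 1) - U s
  rw [add_sub_cancel_right]

lemma bdiff_mul_fwd : bdiff * fwd = fwd - 1 := by
  refine LinearMap.ext fun U => funext fun s => ?_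
  change U (s + 1) - U (s - 1 + 1) = U (s + 1) - U s
  rw [sub_add_cancel]

lemma abs_fwd_sub_one_pow_le (l r : ℕ) {U : ℤ → ℝ} {c : ℝ} (hU : ∀ s, |U s| ≤ c) (s : ℤ) :
    |((fwd ^ l - 1) ^ r) U s| ≤ 2 ^ r * c := by
  induction r generalizing s with
  | zero => simpa using hU s
  | succ r ih =>
    rw [pow_succ', Module.End.mul_apply]
    set W := ((fwd ^ l - 1) ^ r) U with hW
    have e : (fwd ^ l - 1) W s = W (s + l) - W s := by
      rw [LinearMap.sub_apply, Pi.sub_apply, fwd_pow_apply]; rfl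
    rw [e]
    calc _ ≤ |W (s + l)| + |W s| := abs_sub _ _
      _ ≤ 2 ^ r * c + 2 ^ r * c := add_le_add (ih _) (ih _)
      _ = _ := by ring

lemma natDegree_geom_pow_lt {r lamt lam : ℕ} (h1 : 1 ≤ lamt) (h2 : lam = r * lamt - r + 1) :
    ((∑ t ∈ Finset.range lamt, (X : ℝ[X]) ^ t) ^ r).natDegree < lam := by
  have hg : (∑ t ∈ Finset.range lamt, (X : ℝ[X]) ^ t).natDegree ≤ lamt - 1 := by
    refine natDegree_sum_le_of_forall_le _ _ fun t ht => ?_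
    rw [natDegree_X_pow]
    have := Finset.mem_range.mp ht
    omega
  have h3 := natDegree_pow_le_of_le r hg
  have h4 : r * (lamt - 1) = r * lamt - r := by rw [Nat.mul_sub, mul_one]
  omega

/-- Condensing an `r`-th order difference telescopes into an `r`-th order difference of step
`lamt`. -/
lemma abs_sum_sdVec_bdiff_le {r lamt lam : ℕ} (h1 : 1 ≤ lamt) (h2 : lam = r * lamt - r + 1)
    {U : ℤ → ℝ} {c : ℝ} (hU : ∀ s, |U s| ≤ c) (s : ℤ) :
    |∑ j : Fin lam, sdVec r lamt j * (bdiff ^ r) U (s + (j : ℕ))| ≤ 2 ^ r * c := by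
  set P : ℝ[X] := (∑ t ∈ Finset.range lamt, (X : ℝ[X]) ^ t) ^ r with hP
  have hcomm : Commute fwd bdiff := fwd_mul_bdiff.trans bdiff_mul_fwd.symm
  have hkey : aeval fwd P * (fwd ^ r * bdiff ^ r) = (fwd ^ lamt - 1) ^ r := by
    rw [← hcomm.mul_pow, fwd_mul_bdiff]
    have e : P * (X - 1) ^ r = (X ^ lamt - 1) ^ r := by rw [hP, ← mul_pow, geom_sum_mul]
    have := congrArg (aeval fwd) e
    simpa using this
  have hval : ∑ j : Fin lam, sdVec r lamt j * (bdiff ^ r) U (s + (j : ℕ)) =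
      (aeval fwd P) ((bdiff ^ r) U) s := by
    rw [aeval_eq_sum_range' (natDegree_geom_pow_lt h1 h2), LinearMap.sum_apply, Finset.sum_apply,
      ← Fin.sum_univ_eq_sum_range (fun j => ((P.coeff j • fwd ^ j) ((bdiff ^ r) U)) s)]
    refine Finset.sum_congr rfl fun j _ => ?_
    rw [LinearMap.smul_apply, Pi.smul_apply, fwd_pow_apply, smul_eq_mul]
    rfl
  have hshift : (aeval fwd P) ((bdiff ^ r) U) s = ((fwd ^ lamt - 1) ^ r) U (s - r) := by
    have hc : Commute (aeval fwd P) (fwd ^ r) := by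
      have : Commute P (X ^ r) := Commute.all _ _
      have := this.map (aeval (R := ℝ) fwd)
      simpa using this
    rw [← hkey, ← mul_assoc, hc.eq, mul_assoc, Module.End.mul_apply, fwd_pow_apply, sub_add_cancel,
      Module.End.mul_apply]
  rw [hval, hshift]
  exact abs_fwd_sub_one_pow_le lamt r hU _

/-- Extension of a finite sequence by zero. -/
def zext {m : ℕ} (u : Fin m → ℝ) : ℤ → ℝ :=
  fun s => if h : 0 ≤ s ∧ s < m then u ⟨s.toNat, by omega⟩ else 0

lemma zext_natCast {m : ℕ} (u : Fin m → ℝ) (j : Fin m) : zext u (j : ℕ) = u j := by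
  have h : 0 ≤ ((j : ℕ) : ℤ) ∧ ((j : ℕ) : ℤ) < m := ⟨by positivity, by exact_mod_cast j.2⟩
  simp only [zext, h, and_self, dif_pos, Int.toNat_natCast, Fin.eta]

lemma bdiff_pow_neg {U : ℤ → ℝ} (hU : ∀ s < 0, U s = 0) (r : ℕ) : ∀ s < 0, (bdiff ^ r) U s = 0 := by
  induction r with
  | zero => simpa using hU
  | succ r ih =>
    intro s hs
    rw [pow_succ', Module.End.mul_apply, bdiff_apply, ih s hs, ih (s - 1) (by omega), sub_zero]

lemma diffMat_mulVec {m : ℕ} (g : Fin m → ℝ) (W : ℤ → ℝ) (hW : ∀ s < 0, W s = 0)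
    (hg : ∀ j : Fin m, g j = W (j : ℕ)) (j : Fin m) : (diffMat m *ᵥ g) j = bdiff W (j : ℕ) := by
  rw [bdiff_apply]
  have e : ∀ t : Fin m, diffMat m j t * g t =
      (if j = t then W (j : ℕ) else 0) - (if (j : ℕ) = (t : ℕ) + 1 then W (t : ℕ) else 0) := by
    intro t
    simp only [diffMat, Matrix.of_apply, hg, Fin.ext_iff]
    split_ifs with h1 h2 h2
    · omega
    · rw [h1]; ring
    · ring
    · ring
  simp only [Matrix.mulVec, dotProduct, e, Finset.sum_sub_distrib, Finset.sum_ite_eq,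
    Finset.mem_univ, if_true]
  congr 1
  rcases Nat.eq_zero_or_pos (j : ℕ) with h0 | h0
  · rw [h0, hW _ (by norm_num)]
    exact Finset.sum_eq_zero fun t _ => by rw [if_neg (by omega)]
  · have hj : (j : ℕ) - 1 < m := by omega
    rw [Finset.sum_eq_single (⟨(j : ℕ) - 1, hj⟩ : Fin m)]
    · rw [if_pos (by simp only; omega)]
      congr 1
      push_cast [h0]
      rfl
    · intro t _ ht
      rw [if_neg]
      intro h
      exact ht (Fin.ext (by simp only; omega))
    · simp

lemma diffMat_pow_mulVec {m : ℕ} (u : Fin m → ℝ) (r : ℕ) (j : Fin m) :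
    (diffMat m ^ r *ᵥ u) j = (bdiff ^ r) (zext u) (j : ℕ) := by
  have hU : ∀ s < 0, zext u s = 0 := by
    intro s hs
    rw [zext, dif_neg (by omega)]
  induction r generalizing j with
  | zero => simp [zext_natCast]
  | succ r ih =>
    rw [pow_succ', ← Matrix.mulVec_mulVec, pow_succ', Module.End.mul_apply]
    exact diffMat_mulVec _ _ (bdiff_pow_neg hU r) ih j

lemma kronRow_mulVec {p lam : ℕ} (v : Fin lam → ℝ) (g : Fin (p * lam) → ℝ) (i : Fin p) :
    (kronRow p v *ᵥ g) i = ∑ j : Fin lam, v j * g (finProdFinEquiv (i, j)) := by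
  simp only [Matrix.mulVec, dotProduct]
  rw [← finProdFinEquiv.sum_comp, Fintype.sum_prod_type, Finset.sum_eq_single i]
  · refine Finset.sum_congr rfl fun j _ => ?_
    have hlam : 0 < lam := j.pos
    congr 1
    simp [kronRow, Nat.add_mul_div_left _ _ hlam, Nat.div_eq_of_lt j.2, Nat.mod_eq_of_lt j.2]
  · intro i' _ hne
    refine Finset.sum_eq_zero fun j _ => ?_
    have hlam : 0 < lam := j.pos
    have : (i' : ℕ) ≠ i := fun h => hne (Fin.ext h)
    simp [kronRow, Nat.add_mul_div_left _ _ hlam, Nat.div_eq_of_lt j.2, this]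
  · simp

lemma abs_kronRow_diff_le {r lamt lam p : ℕ} (h1 : 1 ≤ lamt) (h2 : lam = r * lamt - r + 1)
    {u : Fin (p * lam) → ℝ} {c : ℝ} (hc : 0 ≤ c) (hu : ∀ j, |u j| ≤ c) (i : Fin p) :
    |(kronRow p (sdVec r lamt : Fin lam → ℝ) *ᵥ (diffMat (p * lam) ^ r *ᵥ u)) i| ≤ 2 ^ r * c := by
  have hU : ∀ s, |zext u s| ≤ c := by
    intro s
    unfold zext
    split_ifs
    · exact hu _
    · simpa using hc
  refine le_trans (le_of_eq ?_) (abs_sum_sdVec_bdiff_le h1 h2 hU ((lam * i : ℕ) : ℤ))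
  rw [kronRow_mulVec]
  congr 1
  refine Finset.sum_congr rfl fun j _ => ?_
  rw [diffMat_pow_mulVec]
  congr 2
  simp only [finProdFinEquiv_apply_val]
  push_cast
  ring_nf

lemma sum_sdVec {r lamt lam : ℕ} (h1 : 1 ≤ lamt) (h2 : lam = r * lamt - r + 1) :
    ∑ j : Fin lam, (sdVec r lamt j : ℝ) = (lamt : ℝ) ^ r := by
  have h := eval_eq_sum_range' (natDegree_geom_pow_lt h1 h2) (1 : ℝ)
  simp only [one_pow, mul_one] at h
  calc _ = _ := Fin.sum_univ_eq_sum_range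
        (fun j => ((∑ t ∈ Finset.range lamt, (X : ℝ[X]) ^ t) ^ r).coeff j) lam
    _ = _ := h.symm
    _ = _ := by simp [eval_finsetSum]

lemma pow_div_sqrt_le_norm2_sdVec {r lamt lam : ℕ} (h1 : 1 ≤ lamt) (h2 : lam = r * lamt - r + 1) :
    (lamt : ℝ) ^ r ≤ Real.sqrt lam * norm2 (sdVec r lamt : Fin lam → ℝ) := by
  rw [norm2, ← Real.sqrt_mul (by positivity)]
  refine Real.le_sqrt_of_sq_le ?_
  rw [← sum_sdVec h1 h2]
  have := sq_sum_le_card_mul_sum_sq (s := (Finset.univ : Finset (Fin lam)))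
    (f := fun j => (sdVec r lamt j : ℝ))
  simpa using this

lemma norm2_sdVec_pos {r lamt lam : ℕ} (h1 : 1 ≤ lamt) (h2 : lam = r * lamt - r + 1) :
    0 < norm2 (sdVec r lamt : Fin lam → ℝ) := by
  have h := pow_div_sqrt_le_norm2_sdVec h1 h2
  have h3 : (0 : ℝ) < (lamt : ℝ) ^ r := by positivity
  by_contra hc
  have := mul_nonpos_of_nonneg_of_nonpos (Real.sqrt_nonneg (lam : ℝ)) (not_lt.mp hc)
  linarith

/-- The condensed quantization error decays like `λ^(-r+1/2)`. -/
lemma norm2_condensed_error_le {r lamt lam p : ℕ} (hr : 1 ≤ r) (h1 : 1 ≤ lamt)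
    (h2 : lam = r * lamt - r + 1) (hp : 0 < p) {u : Fin (p * lam) → ℝ} {c : ℝ} (hc : 0 ≤ c)
    (hu : ∀ j, |u j| ≤ c) :
    norm2 (((9 / (8 * norm2 (sdVec r lamt : Fin lam → ℝ) * Real.sqrt p)) •
      kronRow p (sdVec r lamt : Fin lam → ℝ)) *ᵥ (diffMat (p * lam) ^ r *ᵥ u)) ≤
      9 / 8 * 2 ^ r * c * r ^ r * (lam : ℝ) ^ (-(r : ℝ) + 1 / 2) := by
  set N := norm2 (sdVec r lamt : Fin lam → ℝ) with hN
  have hN0 : 0 < N := norm2_sdVec_pos h1 h2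
  have hp' : (0 : ℝ) < p := by exact_mod_cast hp
  have hlam : (0 : ℝ) < lam := by rw [h2]; positivity
  have hsp : Real.sqrt p ^ 2 = p := Real.sq_sqrt hp'.le
  have hsp0 : 0 < Real.sqrt p := Real.sqrt_pos.mpr hp'
  have hb : norm2 (((9 / (8 * N * Real.sqrt p)) •
      kronRow p (sdVec r lamt : Fin lam → ℝ)) *ᵥ (diffMat (p * lam) ^ r *ᵥ u)) ≤
      9 / 8 * 2 ^ r * c / N := by
    rw [norm2]
    refine Real.sqrt_le_iff.mpr ⟨by positivity, ?_⟩
    calc _ ≤ ∑ _i : Fin p, (9 / (8 * N * Real.sqrt p) * (2 ^ r * c)) ^ 2 := by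
          refine Finset.sum_le_sum fun i _ => ?_
          rw [Matrix.smul_mulVec, Pi.smul_apply, smul_eq_mul, mul_pow, mul_pow]
          refine mul_le_mul_of_nonneg_left ?_ (sq_nonneg _)
          rw [← sq_abs]
          exact pow_le_pow_left₀ (abs_nonneg _) (abs_kronRow_diff_le h1 h2 hc hu i) 2
      _ = p * (9 / (8 * N) * (2 ^ r * c)) ^ 2 / Real.sqrt p ^ 2 := by
          rw [Finset.sum_const, Finset.card_univ, Fintype.card_fin, nsmul_eq_mul]
          field_simp
      _ = _ := by rw [hsp]; field_simp
  refine hb.trans ?_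
  have hle : (lam : ℝ) ≤ r * lamt := by
    have : lam ≤ r * lamt := by
      have : r ≤ r * lamt := Nat.le_mul_of_pos_right r h1
      omega
    exact_mod_cast this
  have hpow : (lam : ℝ) ^ r ≤ r ^ r * (Real.sqrt lam * N) := by
    calc _ ≤ ((r : ℝ) * lamt) ^ r := pow_le_pow_left₀ hlam.le hle r
      _ = r ^ r * (lamt : ℝ) ^ r := mul_pow _ _ _
      _ ≤ _ := mul_le_mul_of_nonneg_left (pow_div_sqrt_le_norm2_sdVec h1 h2) (by positivity)
  have hrp : (lam : ℝ) ^ (-(r : ℝ) + 1 / 2) = Real.sqrt lam / (lam : ℝ) ^ r := by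
    rw [Real.rpow_add hlam, Real.rpow_neg hlam.le, Real.rpow_natCast, ← Real.sqrt_eq_rpow]
    field_simp
  rw [hrp, div_le_iff₀ hN0]
  have hl : 0 < (lam : ℝ) ^ r := by positivity
  have : 1 ≤ r ^ r * (Real.sqrt lam * N) / (lam : ℝ) ^ r := (one_le_div hl).mpr hpow
  calc _ ≤ 9 / 8 * 2 ^ r * c * (r ^ r * (Real.sqrt lam * N) / (lam : ℝ) ^ r) :=
        le_mul_of_one_le_right (by positivity) this
    _ = _ := by ring

end NoiseShaping

section Assembly

open Classical in
lemma one_sub_le_unifProb {Ω : Type*} [Fintype Ω] [Nonempty Ω] {P : Ω → Prop} {q : ℝ}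
    (h : 𝔼 ω, (if P ω then (0 : ℝ) else 1) ≤ q) : 1 - q ≤ unifProb P := by
  have e1 : unifProb P = 𝔼 ω, (if P ω then (1 : ℝ) else 0) := by
    rw [Fintype.expect_eq_sum_div_card, unifProb, Finset.sum_boole, Nat.card_eq_fintype_card,
      Fintype.card_subtype]
  have e2 : (𝔼 ω, (if P ω then (0 : ℝ) else 1)) + 𝔼 ω, (if P ω then (1 : ℝ) else 0) = 1 := by
    rw [← Finset.expect_add_distrib, ← Fintype.expect_const (ι := Ω) (1 : ℝ)]
    exact Finset.expect_congr rfl fun ω _ => by split_ifs <;> norm_num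
  linarith

open Classical in
lemma expect_prod_not_le {A B C : Type*} [Fintype A] [Fintype B] [Fintype C] [Nonempty A]
    [Nonempty B] [Nonempty C] {P : A × B × C → Prop} {R : B → A → Prop} {S : A → B → C → Prop}
    {ρ η : ℝ} (hη : 0 ≤ η) (hR : 𝔼 b, 𝔼 a, (if R b a then (0 : ℝ) else 1) ≤ ρ)
    (hS : ∀ a b, R b a → 𝔼 c, (if S a b c then (0 : ℝ) else 1) ≤ η)
    (hP : ∀ a b c, S a b c → P (a, b, c)) :
    𝔼 ω, (if P ω then (0 : ℝ) else 1) ≤ ρ + η := by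
  have hc : ∀ a b, 𝔼 c, (if P (a, b, c) then (0 : ℝ) else 1) ≤
      (if R b a then (0 : ℝ) else 1) + η := by
    intro a b
    by_cases h : R b a
    · rw [if_pos h, zero_add]
      refine (Finset.expect_le_expect fun c _ => ?_).trans (hS a b h)
      by_cases hs : S a b c
      · rw [if_pos hs, if_pos (hP a b c hs)]
      · rw [if_neg hs]; split_ifs <;> norm_num
    · rw [if_neg h]
      refine (Finset.expect_le Finset.univ_nonempty fun c _ => ?_).trans
        (le_add_of_nonneg_right hη)
      split_ifs <;> norm_num
  calc _ = 𝔼 a, 𝔼 b, 𝔼 c, (if P (a, b, c) then (0 : ℝ) else 1) := by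
        rw [← Finset.univ_product_univ, Finset.expect_product]
        refine Finset.expect_congr rfl fun a _ => ?_
        rw [← Finset.univ_product_univ, Finset.expect_product]
    _ ≤ 𝔼 a, 𝔼 b, ((if R b a then (0 : ℝ) else 1) + η) :=
        Finset.expect_le_expect fun a _ => Finset.expect_le_expect fun b _ => hc a b
    _ = (𝔼 b, 𝔼 a, (if R b a then (0 : ℝ) else 1)) + η := by
        simp only [Finset.expect_add_distrib, Fintype.expect_const]
        rw [Finset.expect_comm]
    _ ≤ _ := by linarith

/-- The block containing a row index. -/
def blockOf (p lam : ℕ) (j : Fin (p * lam)) : Fin p := (finProdFinEquiv.symm j).1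

/-- The normalized condensation weight attached to a row index. -/
def blockWt (p : ℕ) {lam : ℕ} (v : Fin lam → ℝ) (j : Fin (p * lam)) : ℝ :=
  v (finProdFinEquiv.symm j).2 / norm2 v

lemma sum_ite_blockOf {p lam : ℕ} (F : Fin (p * lam) → ℝ) (i : Fin p) :
    ∑ j, (if blockOf p lam j = i then F j else 0) = ∑ j : Fin lam, F (finProdFinEquiv (i, j)) := by
  rw [← finProdFinEquiv.sum_comp, Fintype.sum_prod_type, Finset.sum_eq_single i]
  · simp [blockOf]
  · intro i' _ hne
    simp [blockOf, hne]
  · simp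

lemma sum_blockWt_sq {p lam : ℕ} {v : Fin lam → ℝ} (hv : 0 < norm2 v) (i : Fin p) :
    ∑ j, (if blockOf p lam j = i then blockWt p v j ^ 2 else 0) = 1 := by
  rw [sum_ite_blockOf]
  simp only [blockWt, Equiv.symm_apply_apply, div_pow, ← Finset.sum_div]
  have e : norm2 v ^ 2 = ∑ j, v j ^ 2 := Real.sq_sqrt (Finset.sum_nonneg fun _ _ => sq_nonneg _)
  rw [← e, div_self (by positivity)]

variable {n : ℕ} [NeZero n]

lemma condensed_measurement_eq {p lam : ℕ} {v : Fin lam → ℝ} (hv : 0 < norm2 v)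
    (e : Fin (p * lam) → Fin n) (σ : Fin n → Bool) (ε : Fin (p * lam) → Bool) (z : Fin n → ℝ) :
    ((9 / (8 * norm2 v * Real.sqrt p)) • kronRow p v) *ᵥ (fun j => (8 / 9) *
      ((Matrix.of fun j t => rsign (ε j) * Matrix.circulant (fun s => rsign (σ s)) (e j) t) *ᵥ z) j)
      = convMat (1 / Real.sqrt p) (blk (blockOf p lam) e (blockWt p v) ε) σ *ᵥ z := by
  funext i
  rw [Matrix.smul_mulVec, Pi.smul_apply, kronRow_mulVec, smul_eq_mul]
  simp only [Matrix.mulVec, dotProduct, convMat, Matrix.of_apply, sum_blk_mul, sum_ite_blockOf,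
    Matrix.circulant_apply, blockWt, Equiv.symm_apply_apply, Finset.mul_sum, Finset.sum_mul]
  rw [Finset.sum_comm]
  refine Finset.sum_congr rfl fun t _ => Finset.sum_congr rfl fun j _ => ?_
  simp only [sg]
  field_simp

lemma normInf_measurement_le {m : ℕ} (e : Fin m → Fin n) (σ : Fin n → Bool) (ε : Fin m → Bool)
    (τ : Fin n → Bool) {x : Fin n → ℝ} (hx : norm1 x ≤ 1) :
    normInf (fun j => (8 / 9) * ((Matrix.of fun j t =>
      rsign (ε j) * Matrix.circulant (fun s => rsign (σ s)) (e j) t) *ᵥ (sg τ * x)) j) ≤ 8 / 9 := by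
  refine Real.iSup_le (fun j => ?_) (by norm_num)
  rw [abs_mul, abs_of_pos (by norm_num : (0 : ℝ) < 8 / 9)]
  refine mul_le_of_le_one_right (by norm_num) ?_
  rw [Matrix.mulVec, dotProduct]
  refine (Finset.abs_sum_le_sum_abs _ _).trans ?_
  refine (Finset.sum_le_sum fun t _ => le_of_eq ?_).trans hx
  have h1 := abs_sg ε j
  have h2 := abs_sg σ (e j - t)
  have h3 := abs_sg τ t
  simp only [sg] at h1 h2 h3
  simp [sg, abs_mul, h1, h2, h3]

lemma abs_le_of_normInf_le {m : ℕ} {u : Fin m → ℝ} {c : ℝ} (h : normInf u ≤ c) (j : Fin m) :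
    |u j| ≤ c :=
  (le_ciSup (f := fun j => |u j|) (Set.finite_range _).bddAbove j).trans h

lemma abs_nm_sub_sub_le {β : Type*} [Fintype β] (a g g' : β → ℝ) :
    |nm (a - (g - g')) - nm a| ≤ nm g + nm g' := by
  have h0 := nm_sub_le g g'
  have h1 := nm_sub_le a (g - g')
  have h2 := nm_add_le (a - (g - g')) (g - g')
  rw [sub_add_cancel] at h2
  rw [abs_le]
  constructor <;> linarith

end Assembly

/-- fast binary embedding of a finite set `𝒯 ⊂ B₁ⁿ` via a stable `r`-th
order ΣΔ quantizer applied to sign-randomized partial circulant measurements. -/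
theorem stmt8 (r : ℕ) (hr : 2 ≤ r) (c₀ : ℝ) (hc₀ : 0 < c₀) :
    ∃ C₁ C₂ : ℝ, 0 < C₁ ∧ 0 < C₂ ∧
      ∀ (lamt lam n p : ℕ) (e : Fin (p * lam) → Fin n)
        (Q : (Fin (p * lam) → ℝ) → (Fin (p * lam) → ℝ))
        (T : Finset (Fin n → ℝ)) (α ρ ν : ℝ) (k : ℕ),
        1 ≤ lamt → lam = r * lamt - r + 1 → 2 ≤ n → 0 < p →
        Function.Injective e →
        (∀ y j, Q y j = 1 ∨ Q y j = -1) →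
        (∀ y : Fin (p * lam) → ℝ, normInf y ≤ 8 / 9 →
          ∃ u : Fin (p * lam) → ℝ,
            (∀ j, y j - Q y j = ((diffMat (p * lam)) ^ r).mulVec u j) ∧ normInf u ≤ c₀) →
        (∀ x ∈ T, norm1 x ≤ 1) →
        0 < α → α < 1 → 0 < ρ → ρ < 1 → 0 < ν →
        40 * (Real.log (8 * (T.card : ℝ)) + ν) ≤ (k : ℝ) →
        p ≤ p * lam →
        C₁ * (k : ℝ) * (Real.log n) ^ 4 / (α ^ 2 * ρ ^ 2) ≤ (p : ℝ) →
        unifProb (fun ω : (Fin n → Bool) × (Fin (p * lam) → Bool) × (Fin n → Bool) =>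
            let Φ : Matrix (Fin (p * lam)) (Fin n) ℝ :=
              Matrix.of fun j t =>
                rsign (ω.2.1 j) * Matrix.circulant (fun s => rsign (ω.1 s)) (e j) t
            let Dd : Matrix (Fin n) (Fin n) ℝ := Matrix.diagonal fun t => rsign (ω.2.2 t)
            let f : (Fin n → ℝ) → (Fin (p * lam) → ℝ) :=
              fun x => Q (fun j => (8 / 9) * (Φ * Dd).mulVec x j)
            let Vt : Matrix (Fin p) (Fin (p * lam)) ℝ :=
              (9 / (8 * norm2 (sdVec r lamt : Fin lam → ℝ) * Real.sqrt p)) •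
                kronRow p (sdVec r lamt : Fin lam → ℝ)
            ∀ x ∈ T, ∀ x' ∈ T,
              |norm2 (Vt.mulVec (f x - f x')) - norm2 (x - x')|
                ≤ α * norm2 (x - x') + C₂ * (lam : ℝ) ^ (-(r : ℝ) + 1 / 2))
          ≥ 1 - ρ - Real.exp (-ν) := by
  have hr0 : 0 < r := by omega
  refine ⟨(13000 * 32) ^ 2, 2 * (9 / 8 * 2 ^ r * c₀ * r ^ r), by positivity, by positivity, ?_⟩
  intro lamt lam n p e Q T α ρ ν k hlamt hlam hn hp he _ hstab hT hα hα1 hρ hρ1 hν hk _ hpk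
  have : NeZero n := ⟨by omega⟩
  have : Nonempty (Fin p) := ⟨⟨0, hp⟩⟩
  rw [ge_iff_le, sub_sub]
  apply one_sub_le_unifProb
  rcases T.eq_empty_or_nonempty with rfl | hTne
  · refine (le_of_eq (Finset.expect_eq_zero fun ω _ => ?_)).trans
      (add_nonneg hρ.le (Real.exp_pos _).le)
    rw [if_pos]
    exact fun x hx => absurd hx (Finset.notMem_empty x)
  set v : Fin lam → ℝ := sdVec r lamt with hv
  have hv0 : 0 < norm2 v := norm2_sdVec_pos hlamt hlam
  have hk80 : (80 : ℝ) ≤ k := by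
    have h1 : (1 : ℝ) ≤ T.card := by exact_mod_cast hTne.card_pos
    have h2 : Real.log 8 ≤ Real.log (8 * (T.card : ℝ)) :=
      Real.log_le_log (by norm_num) (by linarith)
    have h3 : Real.log 8 = 3 * Real.log 2 := by
      rw [show (8 : ℝ) = 2 ^ 3 by norm_num, Real.log_pow]; norm_num
    have := Real.log_two_gt_d9
    linarith
  have hrip := expect_not_rip_le_rho (b := blockOf p lam) he (sum_blockWt_sq hv0)
    (by simpa using hn) hk80 hα hα1 hρ hρ1 (K := 32) (by norm_num) (by simpa using hpk)
  rw [Fintype.card_fin] at hrip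
  refine expect_prod_not_le (Real.exp_pos _).le hrip
    (fun σ ε h => expect_not_embedding_le hα h hν hTne (by linarith) hk) ?_
  intro σ ε τ hemb Φ Dd f Vt x hx x' hx'
  have hy : ∀ z, (Φ * Dd) *ᵥ z = Φ *ᵥ (sg τ * z) := by
    intro z
    rw [← Matrix.mulVec_mulVec]
    congr 1
    funext t
    exact Matrix.mulVec_diagonal _ _ _
  have hquant : ∀ z ∈ T, ∃ u : Fin (p * lam) → ℝ, (∀ j, |u j| ≤ c₀) ∧
      f z = (fun j => 8 / 9 * (Φ *ᵥ (sg τ * z)) j) - diffMat (p * lam) ^ r *ᵥ u := by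
    intro z hz
    obtain ⟨u, hu, hu'⟩ := hstab (fun j => 8 / 9 * ((Φ * Dd) *ᵥ z) j) (by
      rw [hy]; exact normInf_measurement_le e σ ε τ (hT z hz))
    refine ⟨u, abs_le_of_normInf_le hu', funext fun j => ?_⟩
    have h := hu j
    rw [Pi.sub_apply, ← hy, ← h]
    simp only [f]
    ring
  obtain ⟨u, hu, hfu⟩ := hquant x hx
  obtain ⟨u', hu', hfu'⟩ := hquant x' hx'
  have hVf : Vt *ᵥ (f x - f x') =
      convMat (1 / Real.sqrt p) (blk (blockOf p lam) e (blockWt p v) ε) σ *ᵥ (sg τ * (x - x')) -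
      (Vt *ᵥ (diffMat (p * lam) ^ r *ᵥ u) - Vt *ᵥ (diffMat (p * lam) ^ r *ᵥ u')) := by
    rw [← condensed_measurement_eq hv0 e σ ε, ← Matrix.mulVec_sub, ← Matrix.mulVec_sub, hfu, hfu']
    congr 1
    funext j
    simp only [Pi.sub_apply, mul_sub, Matrix.mulVec_sub]
    ring
  have herr := norm2_condensed_error_le hr0 hlamt hlam hp hc₀.le hu
  have herr' := norm2_condensed_error_le hr0 hlamt hlam hp hc₀.le hu'
  have hmain := hemb x hx x' hx'
  have htri := abs_nm_sub_sub_le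
    (convMat (1 / Real.sqrt p) (blk (blockOf p lam) e (blockWt p v) ε) σ *ᵥ (sg τ * (x - x')))
    (Vt *ᵥ (diffMat (p * lam) ^ r *ᵥ u)) (Vt *ᵥ (diffMat (p * lam) ^ r *ᵥ u'))
  rw [← hVf] at htri
  have htot := (abs_sub_le (nm (Vt *ᵥ (f x - f x'))) _ (nm (x - x'))).trans (add_le_add htri hmain)
  refine htot.trans ?_
  change norm2 (Vt *ᵥ (diffMat (p * lam) ^ r *ᵥ u)) ≤ _ at herr
  change norm2 (Vt *ᵥ (diffMat (p * lam) ^ r *ᵥ u')) ≤ _ at herr'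
  calc _ ≤ (9 / 8 * 2 ^ r * c₀ * r ^ r * (lam : ℝ) ^ (-(r : ℝ) + 1 / 2) +
        9 / 8 * 2 ^ r * c₀ * r ^ r * (lam : ℝ) ^ (-(r : ℝ) + 1 / 2)) + α * norm2 (x - x') :=
        add_le_add_left (add_le_add herr herr') _
    _ = _ := by ring
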